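/- arXiv:1602.06449 — 3 statements merged into one kernel-verified Lean document; each statement's English description precedes it below -/
import Mathlib

section
/- Inductive description of the sets of planar tree diagrams: for every n ≥ 3 and every r ∈ {1,…,n}, 𝒜(n;r) = {A ≺_k e : A ∈ 𝒜(n−1;r−1), 1 ≤ k ≤ r−2} ∪ {A ≺_j ē : A ∈ 𝒜(n−1;r−1), 1 ≤ j ≤ r−1} ∪ {A ≺_k e : A ∈ 𝒜(n−1;r), r ≤ k ≤ n−1} ∪ {A ≺_j ē : A ∈ 𝒜(n−1;r), r+1 ≤ j ≤ n−1}. -/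
open scoped BigOperators

/-!  Combinatorial framework for Gauss diagrams of (string) links and for the
Kravchenko–Polyak tree diagrams/tree invariants (following the paper
"Tree invariants and Milnor linking numbers with indeterminacy").

Strings of a diagram on `n` strings are indexed by `1, …, n`; each string is
oriented downward from a basepoint at its top, and the position of an endpoint
on its string is a rational number which increases from top to bottom. -/

/-- A Gauss diagram on `n` strings: a finite type of signed arrows, each with a
head endpoint and a tail endpoint lying on strings `1,…,n`, all endpoints
distinct, the endpoints on each string being linearly ordered (top-to-bottom)
by their position. An endpoint is encoded as a pair `(g, b)` where `b = true`
designates the head of the arrow `g` and `b = false` its tail. -/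
structure GaussDiagram (n : ℕ) where
  Arrow : Type
  fin : Fintype Arrow
  dec : DecidableEq Arrow
  /-- the string carrying the head of an arrow -/
  hs : Arrow → ℕ
  /-- the string carrying the tail of an arrow -/
  ts : Arrow → ℕ
  /-- the position of the head on its string (positions increase downward) -/
  hp : Arrow → ℚ
  /-- the position of the tail on its string -/
  tp : Arrow → ℚ
  /-- the sign `ε(g) ∈ {+1, -1}` of an arrow -/
  sign : Arrow → ℤ
  hs_mem : ∀ g, hs g ∈ Finset.Icc 1 n
  ts_mem : ∀ g, ts g ∈ Finset.Icc 1 n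
  sign_unit : ∀ g, sign g = 1 ∨ sign g = -1
  /-- all endpoints are distinct -/
  distinct : ∀ e e' : Arrow × Bool,
    (if e.2 then hs e.1 else ts e.1) = (if e'.2 then hs e'.1 else ts e'.1) →
    (if e.2 then hp e.1 else tp e.1) = (if e'.2 then hp e'.1 else tp e'.1) →
    e = e'

attribute [instance] GaussDiagram.fin GaussDiagram.dec

namespace GaussDiagram

variable {n : ℕ}

/-- the string on which an endpoint lies -/
def estr (G : GaussDiagram n) (e : G.Arrow × Bool) : ℕ :=
  if e.2 then G.hs e.1 else G.ts e.1

/-- the position of an endpoint on its string -/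
def epos (G : GaussDiagram n) (e : G.Arrow × Bool) : ℚ :=
  if e.2 then G.hp e.1 else G.tp e.1

end GaussDiagram

/-- The data of a tree diagram.  By axiom (d2), a tree diagram with leaves
indexed by `I` and trunk `j` has exactly one arrow tailed at each string
`i ∈ I \ {j}`, so its arrows are canonically indexed by `I.erase j`:
`par i` is the string carrying the head of the arrow tailed at string `i`
(the "parent" string), and `rk i` is the rank (counted from the top, starting
at `0`) of the head of this arrow among all the arrowheads lying on the string
`par i`.  By axiom (d4) the tail on a string lies below all the heads on that
string, so `par` and `rk` determine the diagram up to isomorphism.  Junk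
values are pinned by `par i = i` and `rk i = 0` outside `I.erase j`. -/
structure PreTree where
  par : ℕ → ℕ
  rk : ℕ → ℕ

namespace PreTree

/-- `A` is a tree diagram with leaves indexed by `I` and trunk `j`:
axioms (d1)–(d4), together with canonicality of the ranks and the pinning of
junk values. -/
def IsTreeDiagram (I : Finset ℕ) (j : ℕ) (A : PreTree) : Prop :=
  (∀ i ∈ I.erase j, A.par i ∈ I ∧ A.par i ≠ i ∧
      A.rk i < (((I.erase j).filter fun b => A.par b = A.par i)).card) ∧
  (∀ i ∈ I.erase j, ∀ i' ∈ I.erase j,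
      A.par i = A.par i' → A.rk i = A.rk i' → i = i') ∧
  (∀ i, i ∉ I.erase j → A.par i = i ∧ A.rk i = 0)

/-- `A` is planar: the associated rooted tree admits a planar embedding in
which the strings appear in increasing left-to-right order.  Concretely, the
arrows can be drawn as horizontal segments at pairwise distinct heights
`h i` (heights increase downward), compatibly with the order of the endpoints
on each string, in such a way that no arrow crosses the retained part of an
intermediate string (in particular no arrow passes over the trunk). -/
def IsPlanar (I : Finset ℕ) (j : ℕ) (A : PreTree) : Prop :=
  ∃ h : ℕ → ℚ,
    (∀ i ∈ I.erase j, ∀ i' ∈ I.erase j, h i = h i' → i = i') ∧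
    (∀ i ∈ I.erase j, ∀ i' ∈ I.erase j, A.par i = A.par i' →
        (A.rk i < A.rk i' ↔ h i < h i')) ∧
    (∀ i ∈ I.erase j, ∀ i' ∈ I.erase j, A.par i = i' → h i < h i') ∧
    (∀ a ∈ I.erase j, ∀ k ∈ I, min (A.par a) a < k → k < max (A.par a) a →
        k ≠ j ∧ h k < h a)

end PreTree

/-- `𝒜(I;j)`: the set of planar tree diagrams with leaves indexed by `I` and
trunk `j`. -/
def TreeSet (I : Finset ℕ) (j : ℕ) : Set PreTree :=
  {A | A.IsTreeDiagram I j ∧ A.IsPlanar I j}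

/-- `𝒜(n;r) = 𝒜({1,…,n};r)`. -/
def TreeSetFull (n r : ℕ) : Set PreTree :=
  TreeSet (Finset.Icc 1 n) r

/-- `sign(A) = (-1)^q` where `q` is the number of arrows of `A` pointing to
the right, i.e. whose head lies on a higher-indexed string than the tail. -/
def treeSign (I : Finset ℕ) (j : ℕ) (A : PreTree) : ℤ :=
  (-1) ^ (((I.erase j).filter fun i => i < A.par i)).card

/-- A representation `φ` of the tree diagram `A` (with leaves `I`, trunk `j`)
in the Gauss diagram `G`: an injective map from the arrows of `A` (indexed by
their tail strings) to the arrows of `G`, preserving head strings, tail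
strings, and the top-to-bottom order of the endpoints on each string. -/
def IsRep {n : ℕ} (G : GaussDiagram n) (I : Finset ℕ) (j : ℕ) (A : PreTree)
    (φ : {x // x ∈ I.erase j} → G.Arrow) : Prop :=
  Function.Injective φ ∧
  (∀ a, G.hs (φ a) = A.par a.1) ∧
  (∀ a, G.ts (φ a) = a.1) ∧
  (∀ a a', A.par a.1 = A.par a'.1 →
      (A.rk a.1 < A.rk a'.1 ↔ G.hp (φ a) < G.hp (φ a'))) ∧
  (∀ a a', A.par a.1 = a'.1 → G.hp (φ a) < G.tp (φ a'))

/-- `sign(φ) = ∏_{α ∈ A} ε(φ(α))`. -/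
noncomputable def repSign {n : ℕ} (G : GaussDiagram n) {s : Finset ℕ}
    (φ : {x // x ∈ s} → G.Arrow) : ℤ :=
  ∏ᶠ a, G.sign (φ a)

/-- `⟨A,G⟩ = ∑_φ sign(φ)`, the sum over all representations of `A` in `G`. -/
noncomputable def pair {n : ℕ} (G : GaussDiagram n) (I : Finset ℕ) (j : ℕ)
    (A : PreTree) : ℤ :=
  ∑ᶠ (φ : {x // x ∈ I.erase j} → G.Arrow) (_ : IsRep G I j A φ), repSign G φ

/-- `⟨A,G⟩_{α ↦ g}`: the part of `⟨A,G⟩` coming from representations sending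
the arrow `α` of `A` tailed at the string `a` to the arrow `g` of `G`. -/
noncomputable def pairTo {n : ℕ} (G : GaussDiagram n) (I : Finset ℕ) (j : ℕ)
    (A : PreTree) (a : {x // x ∈ I.erase j}) (g : G.Arrow) : ℤ :=
  ∑ᶠ (φ : {x // x ∈ I.erase j} → G.Arrow) (_ : IsRep G I j A φ ∧ φ a = g),
    repSign G φ

/-- `⟨A,G⟩_{α ↛ g}`: the part of `⟨A,G⟩` coming from representations not
sending the arrow `α` of `A` tailed at the string `a` to the arrow `g`. -/
noncomputable def pairNotTo {n : ℕ} (G : GaussDiagram n) (I : Finset ℕ) (j : ℕ)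
    (A : PreTree) (a : {x // x ∈ I.erase j}) (g : G.Arrow) : ℤ :=
  ∑ᶠ (φ : {x // x ∈ I.erase j} → G.Arrow) (_ : IsRep G I j A φ ∧ φ a ≠ g),
    repSign G φ

/-- The tree pairing `⟨Z_{I;j},G⟩ = ∑_{A ∈ 𝒜(I;j)} sign(A)⟨A,G⟩`. -/
noncomputable def Zpair {n : ℕ} (G : GaussDiagram n) (I : Finset ℕ) (j : ℕ) : ℤ :=
  ∑ᶠ (A : PreTree) (_ : A ∈ TreeSet I j), treeSign I j A * pair G I j A

/-- `Δ_Z(I;·) = gcd{⟨Z_{J;k},G⟩ : J ⊊ I, k ∈ J}`. -/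
noncomputable def DeltaZ {n : ℕ} (G : GaussDiagram n) (I : Finset ℕ) : ℤ :=
  (((I.powerset.erase I).sigma fun J => J)).gcd fun p => Zpair G p.1 p.2
/-! ### Moves on Gauss diagrams -/

/-- The endpoints `e₁` and `e₂` (lying on a common string) are consecutive on
their string: no other endpoint lies strictly between them. -/
def Consecutive {n : ℕ} (G : GaussDiagram n) (e₁ e₂ : G.Arrow × Bool) : Prop :=
  ∀ e : G.Arrow × Bool, e ≠ e₁ → e ≠ e₂ → G.estr e = G.estr e₁ →
    ¬ (min (G.epos e₁) (G.epos e₂) < G.epos e ∧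
        G.epos e < max (G.epos e₁) (G.epos e₂))

/-- `ψ` matches arrows of `G` with arrows of `G'` preserving signs, head
strings and tail strings. -/
def ArrowMap {n : ℕ} (G G' : GaussDiagram n) (ψ : G.Arrow → G'.Arrow) : Prop :=
  (∀ g, G'.sign (ψ g) = G.sign g) ∧ (∀ g, G'.hs (ψ g) = G.hs g) ∧
  (∀ g, G'.ts (ψ g) = G.ts g)

/-- `ψ` preserves the relative (top-to-bottom) order of all pairs of endpoints
lying on a common string, except possibly for pairs meeting the set `S`. -/
def OrderPresOn {n : ℕ} (G G' : GaussDiagram n) (ψ : G.Arrow → G'.Arrow)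
    (S : Set (G.Arrow × Bool)) : Prop :=
  ∀ e e' : G.Arrow × Bool, e ∉ S → e' ∉ S → G.estr e = G.estr e' →
    (G.epos e < G.epos e' ↔ G'.epos (ψ e.1, e.2) < G'.epos (ψ e'.1, e'.2))

/-- Basepoint move: on one string, the topmost endpoint becomes the bottommost
endpoint of that string (or vice versa); all other data are unchanged. -/
def BasepointMove {n : ℕ} (G G' : GaussDiagram n) : Prop :=
  ∃ ψ : G.Arrow ≃ G'.Arrow, ArrowMap G G' ψ ∧
    ∃ e₀ : G.Arrow × Bool,
      OrderPresOn G G' ψ {e₀} ∧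
      ((∀ e, e ≠ e₀ → G.estr e = G.estr e₀ →
          G.epos e₀ < G.epos e ∧ G'.epos (ψ e.1, e.2) < G'.epos (ψ e₀.1, e₀.2)) ∨
       (∀ e, e ≠ e₀ → G.estr e = G.estr e₀ →
          G.epos e < G.epos e₀ ∧ G'.epos (ψ e₀.1, e₀.2) < G'.epos (ψ e.1, e.2)))

/-- Insertion of an isolated arrow `g₀` whose head and tail are consecutive
endpoints on a single string (first Reidemeister move). -/
def R1Ins {n : ℕ} (G G' : GaussDiagram n) : Prop :=
  ∃ (ψ : G.Arrow → G'.Arrow) (g₀ : G'.Arrow),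
    Function.Injective ψ ∧ ArrowMap G G' ψ ∧ OrderPresOn G G' ψ ∅ ∧
    (∀ g, ψ g ≠ g₀) ∧ (∀ h, h ≠ g₀ → ∃ g, ψ g = h) ∧
    G'.hs g₀ = G'.ts g₀ ∧ Consecutive G' (g₀, true) (g₀, false)

/-- First Reidemeister move (insertion or deletion). -/
def R1Move {n : ℕ} (G G' : GaussDiagram n) : Prop :=
  R1Ins G G' ∨ R1Ins G' G

/-- Insertion of a parallel pair `g₊, g₋` of arrows of opposite signs, with
heads consecutive on a common string and tails consecutive on a common string,
in parallel position (second Reidemeister move). -/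
def R2Ins {n : ℕ} (G G' : GaussDiagram n) : Prop :=
  ∃ (ψ : G.Arrow → G'.Arrow) (gp gm : G'.Arrow),
    Function.Injective ψ ∧ ArrowMap G G' ψ ∧ OrderPresOn G G' ψ ∅ ∧
    gp ≠ gm ∧ (∀ g, ψ g ≠ gp ∧ ψ g ≠ gm) ∧
    (∀ h, h ≠ gp → h ≠ gm → ∃ g, ψ g = h) ∧
    G'.sign gp = - G'.sign gm ∧ G'.hs gp = G'.hs gm ∧ G'.ts gp = G'.ts gm ∧
    Consecutive G' (gp, true) (gm, true) ∧
    Consecutive G' (gp, false) (gm, false) ∧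
    (G'.hp gp < G'.hp gm ↔ G'.tp gp < G'.tp gm)

/-- Second Reidemeister move (insertion or deletion). -/
def R2Move {n : ℕ} (G G' : GaussDiagram n) : Prop :=
  R2Ins G G' ∨ R2Ins G' G

/-- Third Reidemeister move: the three designated pairs of consecutive
endpoints of the positive arrows `g ∼ (i₁,i₂)`, `h ∼ (i₁,i₃)`, `k ∼ (i₂,i₃)`
have their relative order reversed, all other relative orders of endpoints
being preserved. -/
def R3Move {n : ℕ} (G G' : GaussDiagram n) : Prop :=
  ∃ (ψ : G.Arrow ≃ G'.Arrow) (g h k : G.Arrow),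
    ArrowMap G G' ψ ∧
    g ≠ h ∧ g ≠ k ∧ h ≠ k ∧
    G.sign g = 1 ∧ G.sign h = 1 ∧ G.sign k = 1 ∧
    G.hs h = G.hs g ∧ G.hs k = G.ts g ∧ G.ts k = G.ts h ∧
    Consecutive G (g, true) (h, true) ∧
    Consecutive G (g, false) (k, true) ∧
    Consecutive G (h, false) (k, false) ∧
    (G.epos (g, true) < G.epos (h, true) ↔
      G'.epos (ψ h, true) < G'.epos (ψ g, true)) ∧
    (G.epos (g, false) < G.epos (k, true) ↔
      G'.epos (ψ k, true) < G'.epos (ψ g, false)) ∧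
    (G.epos (h, false) < G.epos (k, false) ↔
      G'.epos (ψ k, false) < G'.epos (ψ h, false)) ∧
    (∀ e e' : G.Arrow × Bool, G.estr e = G.estr e' →
      ¬ (({e, e'} : Set (G.Arrow × Bool)) = {(g, true), (h, true)} ∨
         ({e, e'} : Set (G.Arrow × Bool)) = {(g, false), (k, true)} ∨
         ({e, e'} : Set (G.Arrow × Bool)) = {(h, false), (k, false)}) →
      (G.epos e < G.epos e' ↔ G'.epos (ψ e.1, e.2) < G'.epos (ψ e'.1, e'.2)))

/-- `G` and `G'` have identical sets of arrows with head and tail on distinct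
strings (same signs, same head/tail strings, same relative order of the
endpoints of these arrows on each string); they may differ arbitrarily in
arrows whose head and tail lie on the same string.  This is the equivalence
generated by the self-arrow moves (insertion, deletion, sign change of an
arrow with both endpoints on one string). -/
def MixedEquiv {n : ℕ} (G G' : GaussDiagram n) : Prop :=
  ∃ ψ : {g : G.Arrow // G.hs g ≠ G.ts g} ≃ {g : G'.Arrow // G'.hs g ≠ G'.ts g},
    (∀ g, G'.sign (ψ g).1 = G.sign g.1) ∧
    (∀ g, G'.hs (ψ g).1 = G.hs g.1) ∧
    (∀ g, G'.ts (ψ g).1 = G.ts g.1) ∧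
    (∀ (g g' : {g : G.Arrow // G.hs g ≠ G.ts g}) (b b' : Bool),
      G.estr (g.1, b) = G.estr (g'.1, b') →
      (G.epos (g.1, b) < G.epos (g'.1, b') ↔
        G'.epos ((ψ g).1, b) < G'.epos ((ψ g').1, b')))

/-- A single arrow `g` of `G` is replaced by the arrow `g' = ψ g` of `G'` with
the same sign, head string and tail string, in a possibly different position;
all other arrows and all relative orders of their endpoints are unchanged. -/
def MovedArrow {n : ℕ} (G G' : GaussDiagram n) (g : G.Arrow) (g' : G'.Arrow) :
    Prop :=
  ∃ ψ : G.Arrow ≃ G'.Arrow, ψ g = g' ∧ ArrowMap G G' ψ ∧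
    ∀ e e' : G.Arrow × Bool, e.1 ≠ g → e'.1 ≠ g → G.estr e = G.estr e' →
      (G.epos e < G.epos e' ↔ G'.epos (ψ e.1, e.2) < G'.epos (ψ e'.1, e'.2))
/-! ### Stacking of planar tree diagrams -/

/-- Relabelling of the strings of `P` (a planar tree diagram on the strings
`1,…,n` with trunk `r`) when a diagram on `m` strings with trunk `s` is stacked
onto its `k`-th leaf: strings left of `k` keep their index, the `k`-th string
is glued onto the trunk of the stacked diagram (index `k+s-1`), and strings
right of `k` are shifted by `m-1`. -/
def embP (k m s p : ℕ) : ℕ :=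
  if p < k then p else if p = k then k + s - 1 else p + m - 1

/-- The inverse relabelling: the string of `P` from which the string `i` of
`P ≺ₖ Q` originates. -/
def invP (k m s i : ℕ) : ℕ :=
  if i < k then i else if i = k + s - 1 then k else i - (m - 1)

/-- The number of arrowheads lying on the trunk string of the tree diagram `Q`
on `m` strings with trunk `s`. -/
def qcount (m s : ℕ) (Q : PreTree) : ℕ :=
  ((((Finset.Icc 1 m).erase s)).filter fun q => Q.par q = s).card

/-- The stacking `P ≺ₖ Q` of the tree diagram `Q` (on `m` strings, trunk `s`)
onto the `k`-th leaf of the tree diagram `P`: the trunk string of `Q` is glued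
onto the `k`-th leaf string of `P` (the arrows of `Q` lying above those of `P`
on the glued string) and the resulting strings are renumbered `1,…,n+m-1` in
left-to-right planar order, the strings of `Q` occupying positions
`k,…,k+m-1`. -/
def stack (k m s : ℕ) (P Q : PreTree) : PreTree where
  par i :=
    if k ≤ i ∧ i ≤ k + m - 1 ∧ i ≠ k + s - 1 then
      k + Q.par (i - k + 1) - 1
    else
      embP k m s (P.par (invP k m s i))
  rk i :=
    if k ≤ i ∧ i ≤ k + m - 1 ∧ i ≠ k + s - 1 then
      Q.rk (i - k + 1)
    else if P.par (invP k m s i) = k ∧ invP k m s i ≠ k then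
      P.rk (invP k m s i) + qcount m s Q
    else
      P.rk (invP k m s i)

/-- The trunk of `P ≺ₖ Q` (where `P` has trunk `r` and `Q` has `m` strings and
trunk `s`). -/
def stackTrunk (r k m s : ℕ) : ℕ :=
  if r < k then r else if k < r then r + m - 1 else k + s - 1

/-- The elementary tree `e ∈ 𝒜(2;1)`: one arrow with head on string `1` (the
trunk) and tail on string `2`. -/
def etree : PreTree :=
  ⟨fun i => if i = 2 then 1 else i, fun _ => 0⟩

/-- The elementary tree `ē ∈ 𝒜(2;2)`: one arrow with head on string `2` (the
trunk) and tail on string `1`. -/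
def ebar : PreTree :=
  ⟨fun i => if i = 1 then 2 else i, fun _ => 0⟩

/-- The `k`-th smallest element of the finite set `I` (`1`-indexed). -/
def enumIn (I : Finset ℕ) (k : ℕ) : ℕ :=
  (I.sort (· ≤ ·)).getD (k - 1) 0

/-- The (`1`-indexed) rank of `x` in the finite set `I`. -/
def rankIn (I : Finset ℕ) (x : ℕ) : ℕ :=
  ((I.filter fun y => y ≤ x)).card

/-- Relabel a tree diagram on the strings `1,…,|I|` so that its strings are
indexed by the elements of `I` (in increasing order); this realizes a tree
diagram `A' ∈ 𝒜(I;·)` from `A ∈ 𝒜(|I|;·)` as in the pairing `⟨A, G(I)⟩`. -/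
def relabel (I : Finset ℕ) (P : PreTree) : PreTree where
  par x := if x ∈ I then enumIn I (P.par (rankIn I x)) else x
  rk x := if x ∈ I then P.rk (rankIn I x) else 0

/-! ### Adding and removing a leaf -/

/-- The increasing map `ℕ → ℕ` whose range misses exactly `x`. -/
def skip (x i : ℕ) : ℕ := if i < x then i else i + 1

/-- The left inverse of `skip x`. -/
def unskip (x i : ℕ) : ℕ := if i < x then i else i - 1

theorem skip_ne (x i : ℕ) : skip x i ≠ x := by unfold skip; split_ifs <;> omega

theorem unskip_skip (x i : ℕ) : unskip x (skip x i) = i := by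
  unfold skip unskip; split_ifs <;> omega

theorem skip_unskip {x i : ℕ} (h : i ≠ x) : skip x (unskip x i) = i := by
  unfold skip unskip; split_ifs <;> omega

theorem skip_lt_skip {x i j : ℕ} : skip x i < skip x j ↔ i < j := by
  unfold skip; split_ifs <;> omega

theorem skip_inj {x i j : ℕ} : skip x i = skip x j ↔ i = j := by
  unfold skip; split_ifs <;> omega

theorem skip_mem_Icc {n x i : ℕ} (hx : x ∈ Finset.Icc 1 n) :
    skip x i ∈ Finset.Icc 1 n ↔ i ∈ Finset.Icc 1 (n - 1) := by
  simp only [Finset.mem_Icc] at *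
  unfold skip; split_ifs <;> omega

theorem skip_mem_erase {n x t i : ℕ} (hx : x ∈ Finset.Icc 1 n) :
    skip x i ∈ (Finset.Icc 1 n).erase (skip x t) ↔ i ∈ (Finset.Icc 1 (n - 1)).erase t := by
  rw [Finset.mem_erase, Finset.mem_erase, skip_mem_Icc hx, Ne, Ne, skip_inj]

theorem forall_iff_skip (x : ℕ) (P : ℕ → Prop) : (∀ i, P i) ↔ P x ∧ ∀ i, P (skip x i) := by
  refine ⟨fun h => ⟨h _, fun i => h _⟩, fun ⟨h₁, h₂⟩ i => ?_⟩
  by_cases hi : i = x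
  · exact hi ▸ h₁
  · exact skip_unskip hi ▸ h₂ (unskip x i)

namespace PreTree

theorem ext_par_rk {A B : PreTree} (hp : ∀ i, A.par i = B.par i) (hr : ∀ i, A.rk i = B.rk i) :
    A = B := by
  cases A; cases B
  simp only [mk.injEq]
  exact ⟨funext hp, funext hr⟩

/-- The diagram obtained from `A` by inserting a new string at position `x`, with a single arrow
from it to the top of the string `skip x q`. -/
def addLeaf (x q : ℕ) (A : PreTree) : PreTree where
  par i := if i = x then skip x q else skip x (A.par (unskip x i))
  rk i := if i = x then 0 else
    if A.par (unskip x i) = q ∧ unskip x i ≠ q then A.rk (unskip x i) + 1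
    else A.rk (unskip x i)

variable {n x q t : ℕ} {A : PreTree}

theorem addLeaf_par_self : (addLeaf x q A).par x = skip x q := by simp [addLeaf]

theorem addLeaf_rk_self : (addLeaf x q A).rk x = 0 := by simp [addLeaf]

theorem addLeaf_par_skip (i : ℕ) : (addLeaf x q A).par (skip x i) = skip x (A.par i) := by
  simp [addLeaf, skip_ne, unskip_skip]

theorem addLeaf_rk_skip (i : ℕ) : (addLeaf x q A).rk (skip x i) =
    if A.par i = q ∧ i ≠ q then A.rk i + 1 else A.rk i := by
  simp [addLeaf, skip_ne, unskip_skip]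

theorem card_children_addLeaf (hx : x ∈ Finset.Icc 1 n) (p : ℕ) :
    (((Finset.Icc 1 n).erase (skip x t)).filter fun b =>
      (addLeaf x q A).par b = skip x p).card =
    (((Finset.Icc 1 (n - 1)).erase t).filter fun b => A.par b = p).card +
      if p = q then 1 else 0 := by
  have key : (((Finset.Icc 1 n).erase (skip x t)).filter fun b =>
      (addLeaf x q A).par b = skip x p) =
      ((((Finset.Icc 1 (n - 1)).erase t).filter fun b => A.par b = p).image (skip x)) ∪
        (if p = q then {x} else ∅) := by
    ext b
    revert b
    rw [forall_iff_skip x]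
    constructor
    · have h₁ : x ∈ (Finset.Icc 1 n).erase (skip x t) :=
        Finset.mem_erase.2 ⟨(skip_ne x t).symm, hx⟩
      have h₂ : ∀ a, skip x a ≠ x := skip_ne x
      by_cases hpq : p = q <;>
        simp [h₁, h₂, hpq, addLeaf_par_self, skip_inj, -Finset.mem_erase, eq_comm (a := q)]
    · intro i
      have h₂ : skip x i ≠ x := skip_ne x i
      by_cases hpq : p = q <;>
        simp [h₂, hpq, addLeaf_par_skip, skip_inj, skip_mem_erase hx, -Finset.mem_erase]
  rw [key, Finset.card_union_of_disjoint, Finset.card_image_of_injective]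
  · split_ifs <;> simp
  · exact fun a b h => skip_inj.1 h
  · split_ifs
    · simp [skip_ne]
    · simp

theorem isTreeDiagram_addLeaf (hx : x ∈ Finset.Icc 1 n) (hq : q ∈ Finset.Icc 1 (n - 1)) :
    (addLeaf x q A).IsTreeDiagram (Finset.Icc 1 n) (skip x t) ↔
      A.IsTreeDiagram (Finset.Icc 1 (n - 1)) t := by
  have hxm : x ∈ (Finset.Icc 1 n).erase (skip x t) :=
    Finset.mem_erase.2 ⟨(skip_ne x t).symm, hx⟩
  unfold IsTreeDiagram
  rw [forall_iff_skip x, forall_iff_skip x (fun i => i ∈ (Finset.Icc 1 n).erase (skip x t) → _),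
    forall_iff_skip x (fun i => i ∉ (Finset.Icc 1 n).erase (skip x t) → _)]
  simp only [forall_iff_skip x (fun i => i ∈ (Finset.Icc 1 n).erase (skip x t) → _ → _ → _)]
  simp only [skip_mem_erase hx, hxm, addLeaf_par_self, addLeaf_rk_self, addLeaf_par_skip,
    addLeaf_rk_skip, card_children_addLeaf hx, skip_inj, skip_mem_Icc hx, hq, skip_ne, Ne]
  constructor
  · rintro ⟨⟨-, h₁⟩, ⟨-, h₂⟩, -, h₃⟩
    refine ⟨fun i hi => ?_, fun i hi j hj hij hr => ?_, fun i hi => ?_⟩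
    · grind
    · have := (h₂ i hi).2 j hj
      have := h₁ i hi
      have := h₁ j hj
      grind
    · grind
  · rintro ⟨h₁, h₂, h₃⟩
    refine ⟨⟨fun _ => ⟨trivial, not_false, by simp⟩, fun i hi => ?_⟩,
      ⟨fun _ => ⟨fun _ _ _ => trivial, fun j hj => ?_⟩, fun i hi => ⟨fun _ => ?_, fun j hj => ?_⟩⟩,
      fun h => absurd trivial h, fun i hi => ?_⟩
    · grind
    · grind
    · grind
    · have := h₂ i hi j hj
      have := h₁ i hi
      have := h₁ j hj
      grind
    · grind

theorem isPlanar_addLeaf (hx : x ∈ Finset.Icc 1 n) (hxq : x = q ∨ x = q + 1)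
    (hA : A.IsTreeDiagram (Finset.Icc 1 (n - 1)) t)
    (h : A.IsPlanar (Finset.Icc 1 (n - 1)) t) :
    (addLeaf x q A).IsPlanar (Finset.Icc 1 n) (skip x t) := by
  obtain ⟨h, h₁, h₂, h₃, h₄⟩ := h
  obtain ⟨m, hm⟩ : ∃ m, ∀ i ∈ Finset.Icc 1 (n - 1), m < h i := by
    obtain ⟨m, hm⟩ := ((Finset.Icc 1 (n - 1)).image h).finite_toSet.bddBelow
    exact ⟨m - 1, fun i hi => by
      have := hm (Finset.mem_coe.2 (Finset.mem_image_of_mem h hi)); linarith⟩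
  have hm' : ∀ i ∈ (Finset.Icc 1 (n - 1)).erase t, m < h i :=
    fun i hi => hm i (Finset.mem_of_mem_erase hi)
  have hself : (fun i => if i = x then m else h (unskip x i)) x = m := by simp
  have hskip : ∀ i, (fun i => if i = x then m else h (unskip x i)) (skip x i) = h i := by
    simp [skip_ne, unskip_skip]
  generalize (fun i => if i = x then m else h (unskip x i)) = g at hself hskip
  have hxm : x ∈ (Finset.Icc 1 n).erase (skip x t) :=
    Finset.mem_erase.2 ⟨(skip_ne x t).symm, hx⟩
  have hmono := (show StrictMono (skip x) from fun a b h => skip_lt_skip.2 h).monotone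
  refine ⟨g, ?_⟩
  rw [forall_iff_skip x, forall_iff_skip x (fun i => i ∈ (Finset.Icc 1 n).erase (skip x t) →
      ∀ j ∈ (Finset.Icc 1 n).erase (skip x t), _ → (_ ↔ _)),
    forall_iff_skip x (fun i => i ∈ (Finset.Icc 1 n).erase (skip x t) →
      ∀ j ∈ (Finset.Icc 1 n).erase (skip x t), _ → _ < _),
    forall_iff_skip x (fun i => i ∈ (Finset.Icc 1 n).erase (skip x t) →
      ∀ j ∈ (Finset.Icc 1 n), _)]
  simp only [forall_iff_skip x (fun i => i ∈ (Finset.Icc 1 n).erase (skip x t) → _ → _),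
    forall_iff_skip x (fun i => i ∈ (Finset.Icc 1 n) → _)]
  simp only [skip_mem_erase hx, hxm, addLeaf_par_self, addLeaf_rk_self, addLeaf_par_skip,
    addLeaf_rk_skip, skip_inj, skip_mem_Icc hx, skip_ne, hx, hself, hskip, ← hmono.map_min,
    ← hmono.map_max, skip_lt_skip, Ne]
  refine ⟨?_, ?_, ?_, ?_⟩
  · grind
  · have hrk : ∀ i ∈ (Finset.Icc 1 (n - 1)).erase t, A.par i = q → i ≠ q :=
      fun i hi hiq hi' => (hA.1 i hi).2.1 (hiq.trans hi'.symm)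
    refine ⟨fun _ => ⟨by simp, fun j hj hqj => ?_⟩,
      fun i hi => ⟨fun _ hiq => ?_, fun j hj hij => ?_⟩⟩
    · simp [hqj.symm, hrk j hj hqj.symm, hm' j hj]
    · simp [(hm' i hi).le]
    · rw [← h₂ i hi j hj hij]
      have := hrk i hi
      have := hrk j hj
      split_ifs <;> grind
  · grind
  · refine ⟨fun _ => ⟨?_, fun i hi hlt hgt => ?_⟩,
      fun i hi => ⟨fun _ _ _ => ⟨(skip_ne x t).symm, hm' i hi⟩, h₄ i hi⟩⟩
    · simp only [skip]
      split_ifs <;> omega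
    · exfalso
      simp only [skip] at hlt hgt
      split_ifs at hlt hgt <;> omega

theorem IsPlanar.of_addLeaf (hx : x ∈ Finset.Icc 1 n)
    (hA : A.IsTreeDiagram (Finset.Icc 1 (n - 1)) t)
    (h : (addLeaf x q A).IsPlanar (Finset.Icc 1 n) (skip x t)) :
    A.IsPlanar (Finset.Icc 1 (n - 1)) t := by
  obtain ⟨h, h₁, h₂, h₃, h₄⟩ := h
  have hmono := (show StrictMono (skip x) from fun a b h => skip_lt_skip.2 h).monotone
  refine ⟨fun i => h (skip x i), fun i hi j hj => ?_, fun i hi j hj hij => ?_,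
    fun i hi j hj => ?_, fun a ha k hk => ?_⟩
  · have := h₁ _ ((skip_mem_erase hx).2 hi) _ ((skip_mem_erase hx).2 hj)
    rwa [skip_inj] at this
  · have := h₂ _ ((skip_mem_erase hx).2 hi) _ ((skip_mem_erase hx).2 hj)
    rw [addLeaf_par_skip, addLeaf_par_skip, skip_inj, addLeaf_rk_skip, addLeaf_rk_skip] at this
    rw [← this hij]
    have := hA.1 i hi
    have := hA.1 j hj
    grind
  · have := h₃ _ ((skip_mem_erase hx).2 hi) _ ((skip_mem_erase hx).2 hj)
    rwa [addLeaf_par_skip, skip_inj] at this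
  · have := h₄ _ ((skip_mem_erase hx).2 ha) _ ((skip_mem_Icc hx).2 hk)
    rwa [addLeaf_par_skip, ← hmono.map_min, ← hmono.map_max, skip_lt_skip, skip_lt_skip, Ne,
      skip_inj] at this

/-- The diagram obtained from `B` by deleting the string `x`, whose arrow ends at the top of the
string `skip x q`. -/
def removeLeaf (x q : ℕ) (B : PreTree) : PreTree where
  par i := unskip x (B.par (skip x i))
  rk i := if B.par (skip x i) = skip x q ∧ i ≠ q then B.rk (skip x i) - 1 else B.rk (skip x i)

theorem addLeaf_removeLeaf {B : PreTree} (hpar : B.par x = skip x q) (hrk : B.rk x = 0)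
    (hx : ∀ i ≠ x, B.par i ≠ x)
    (hpos : ∀ i, i ≠ x → i ≠ skip x q → B.par i = skip x q → B.rk i ≠ 0) :
    addLeaf x q (removeLeaf x q B) = B := by
  apply ext_par_rk
  · rw [forall_iff_skip x]
    refine ⟨by rw [addLeaf_par_self, hpar], fun i => ?_⟩
    rw [addLeaf_par_skip, removeLeaf, skip_unskip (hx _ (skip_ne x i))]
  · rw [forall_iff_skip x]
    refine ⟨by rw [addLeaf_rk_self, hrk], fun i => ?_⟩
    have h₁ := hpos (skip x i) (skip_ne x i)
    have h₂ : unskip x (B.par (skip x i)) = q ↔ B.par (skip x i) = skip x q := by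
      rw [← skip_inj (x := x), skip_unskip (hx _ (skip_ne x i))]
    rw [Ne, skip_inj] at h₁
    simp only [addLeaf_rk_skip, removeLeaf, h₂]
    grind

theorem IsTreeDiagram.exists_rk_eq_zero {I : Finset ℕ} {j i : ℕ} (hA : A.IsTreeDiagram I j)
    (hi : i ∈ I.erase j) : ∃ b ∈ I.erase j, A.par b = A.par i ∧ A.rk b = 0 := by
  set F := (I.erase j).filter fun b => A.par b = A.par i
  have hF : ∀ b ∈ F, b ∈ I.erase j ∧ A.par b = A.par i := fun b hb => Finset.mem_filter.1 hb
  have himg : F.image A.rk = Finset.range F.card := by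
    apply Finset.eq_of_subset_of_card_le
    · intro k hk
      obtain ⟨b, hb, rfl⟩ := Finset.mem_image.1 hk
      have := (hA.1 b (hF b hb).1).2.2
      rw [(hF b hb).2] at this
      exact Finset.mem_range.2 this
    · rw [Finset.card_image_of_injOn, Finset.card_range]
      intro a ha b hb hab
      exact hA.2.1 a (hF a ha).1 b (hF b hb).1 ((hF a ha).2.trans (hF b hb).2.symm) hab
  have h₀ : 0 ∈ F.image A.rk := by
    rw [himg, Finset.mem_range, Finset.card_pos]
    exact ⟨i, Finset.mem_filter.2 ⟨hi, rfl⟩⟩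
  obtain ⟨b, hb, hb₀⟩ := Finset.mem_image.1 h₀
  exact ⟨b, (hF b hb).1, (hF b hb).2, hb₀⟩

theorem addLeaf_mem_treeSetFull (hq : q ∈ Finset.Icc 1 (n - 1)) (hxq : x = q ∨ x = q + 1)
    (hA : A ∈ TreeSetFull (n - 1) t) : addLeaf x q A ∈ TreeSetFull n (skip x t) := by
  have hx : x ∈ Finset.Icc 1 n := by
    rw [Finset.mem_Icc] at *
    omega
  exact ⟨(isTreeDiagram_addLeaf hx hq).2 hA.1, isPlanar_addLeaf hx hxq hA.1 hA.2⟩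

theorem exists_addLeaf_of_mem_treeSetFull {r : ℕ} {B : PreTree} (hn : 2 ≤ n)
    (hr : r ∈ Finset.Icc 1 n) (hB : B ∈ TreeSetFull n r) :
    ∃ x q t, q ∈ Finset.Icc 1 (n - 1) ∧ (x = q ∨ x = q + 1) ∧ skip x t = r ∧
      ∃ A ∈ TreeSetFull (n - 1) t, B = addLeaf x q A := by
  obtain ⟨hB, hp⟩ := hB
  obtain ⟨h, h₁, h₂, h₃, h₄⟩ := id hp
  have hne : ((Finset.Icc 1 n).erase r).Nonempty := by
    rw [← Finset.card_pos, Finset.card_erase_of_mem hr, Nat.card_Icc]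
    omega
  obtain ⟨x, hx, hmin⟩ := Finset.exists_min_image _ h hne
  have hx' := Finset.mem_of_mem_erase hx
  obtain ⟨hpx, hpx', -⟩ := hB.1 x hx
  have hadj : x = B.par x + 1 ∨ B.par x = x + 1 := by
    by_contra hcon
    have hk : ∃ k ∈ Finset.Icc 1 n, min (B.par x) x < k ∧ k < max (B.par x) x := by
      rw [Finset.mem_Icc] at hpx hx'
      refine ⟨min (B.par x) x + 1, ?_, by omega, by omega⟩
      rw [Finset.mem_Icc]
      omega
    obtain ⟨k, hk, hlt, hgt⟩ := hk
    obtain ⟨hkr, hlt⟩ := h₄ x hx k hk hlt hgt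
    exact (hmin k (Finset.mem_erase.2 ⟨hkr, hk⟩)).not_gt hlt
  have hrk : B.rk x = 0 := by
    obtain ⟨b, hb, hbx, hb₀⟩ := hB.exists_rk_eq_zero hx
    by_contra hne
    have := (h₂ b hb x hx hbx).1 (by omega)
    exact (hmin b hb).not_gt this
  have hchild : ∀ i ≠ x, B.par i ≠ x := by
    intro i hi hix
    by_cases him : i ∈ (Finset.Icc 1 n).erase r
    · exact (hmin i him).not_gt (h₃ i him x hx hix)
    · exact hi ((hB.2.2 i him).1.symm.trans hix)
  have hpos : ∀ i, i ≠ x → i ≠ B.par x → B.par i = B.par x → B.rk i ≠ 0 := by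
    intro i hi hip hix hi₀
    by_cases him : i ∈ (Finset.Icc 1 n).erase r
    · exact hi (hB.2.1 i him x hx hix (hi₀.trans hrk.symm))
    · exact hip ((hB.2.2 i him).1.symm.trans hix)
  have hq := skip_unskip hpx'
  have ht := skip_unskip (Finset.ne_of_mem_erase hx).symm
  rw [← hq] at hpos
  have hBA := (addLeaf_removeLeaf hq.symm hrk hchild hpos).symm
  have hqm : unskip x (B.par x) ∈ Finset.Icc 1 (n - 1) := by rwa [← skip_mem_Icc hx', hq]
  refine ⟨x, unskip x (B.par x), unskip x r, hqm, ?_, ht, _, ?_, hBA⟩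
  · unfold unskip
    split_ifs <;> omega
  · rw [hBA, ← ht] at hB hp
    have hA := (isTreeDiagram_addLeaf hx' hqm).1 hB
    exact ⟨hA, hp.of_addLeaf hx' hA⟩

end PreTree

theorem stack_etree (k : ℕ) (A : PreTree) : stack k 2 1 A etree = A.addLeaf (k + 1) k := by
  have hc : qcount 2 1 etree = 1 := by decide
  apply PreTree.ext_par_rk
  · intro i
    simp only [stack, PreTree.addLeaf, etree, embP, invP, skip, unskip]
    grind
  · intro i
    simp only [stack, PreTree.addLeaf, hc]
    simp only [etree, invP, unskip]
    grind

theorem stack_ebar (k : ℕ) (A : PreTree) : stack k 2 2 A ebar = A.addLeaf k k := by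
  have hc : qcount 2 2 ebar = 1 := by decide
  apply PreTree.ext_par_rk
  · intro i
    simp only [stack, PreTree.addLeaf, ebar, embP, invP, skip, unskip]
    grind
  · intro i
    simp only [stack, PreTree.addLeaf, hc]
    simp only [ebar, invP, unskip]
    grind

/-- **Inductive description of the sets of planar tree diagrams.**  For every
`n ≥ 3` and `r ∈ {1,…,n}`,
`𝒜(n;r) = {A ≺ₖ e : A ∈ 𝒜(n-1;r-1), 1 ≤ k ≤ r-2}
        ∪ {A ≺ⱼ ē : A ∈ 𝒜(n-1;r-1), 1 ≤ j ≤ r-1}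
        ∪ {A ≺ₖ e : A ∈ 𝒜(n-1;r), r ≤ k ≤ n-1}
        ∪ {A ≺ⱼ ē : A ∈ 𝒜(n-1;r), r+1 ≤ j ≤ n-1}`. -/
theorem tree_inductive_description (n r : ℕ) (hn : 3 ≤ n)
    (hr : 1 ≤ r) (hrn : r ≤ n) :
    TreeSetFull n r =
      {B | ∃ A ∈ TreeSetFull (n - 1) (r - 1),
          ∃ k, 1 ≤ k ∧ k ≤ r - 2 ∧ B = stack k 2 1 A etree} ∪
      {B | ∃ A ∈ TreeSetFull (n - 1) (r - 1),
          ∃ j, 1 ≤ j ∧ j ≤ r - 1 ∧ B = stack j 2 2 A ebar} ∪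
      {B | ∃ A ∈ TreeSetFull (n - 1) r,
          ∃ k, r ≤ k ∧ k ≤ n - 1 ∧ B = stack k 2 1 A etree} ∪
      {B | ∃ A ∈ TreeSetFull (n - 1) r,
          ∃ j, r + 1 ≤ j ∧ j ≤ n - 1 ∧ B = stack j 2 2 A ebar} := by
  ext B
  simp only [Set.mem_union, Set.mem_ofPred_eq, stack_etree, stack_ebar]
  constructor
  · intro hB
    obtain ⟨x, q, t, hq, hxq, rfl, A, hA, rfl⟩ :=
      PreTree.exists_addLeaf_of_mem_treeSetFull (by omega) (Finset.mem_Icc.2 ⟨hr, hrn⟩) hB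
    rw [Finset.mem_Icc] at hq
    obtain rfl | rfl := hxq
    · by_cases htx : t < x
      · rw [skip, if_pos htx]
        exact Or.inr ⟨A, hA, x, by omega, by omega, rfl⟩
      · rw [skip, if_neg htx]
        exact Or.inl (Or.inl (Or.inr ⟨A, hA, x, by omega, by omega, rfl⟩))
    · by_cases htx : t < q + 1
      · rw [skip, if_pos htx]
        exact Or.inl (Or.inr ⟨A, hA, q, by omega, by omega, rfl⟩)
      · rw [skip, if_neg htx]
        exact Or.inl (Or.inl (Or.inl ⟨A, hA, q, by omega, by omega, rfl⟩))
  · rintro (((⟨A, hA, k, hk₁, hk₂, rfl⟩ | ⟨A, hA, k, hk₁, hk₂, rfl⟩) |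
      ⟨A, hA, k, hk₁, hk₂, rfl⟩) | ⟨A, hA, k, hk₁, hk₂, rfl⟩)
    · convert PreTree.addLeaf_mem_treeSetFull (q := k) (x := k + 1)
        (Finset.mem_Icc.2 ⟨by omega, by omega⟩) (Or.inr rfl) hA using 1
      rw [skip, if_neg (by omega)]
      congr
      omega
    · convert PreTree.addLeaf_mem_treeSetFull (q := k) (x := k)
        (Finset.mem_Icc.2 ⟨by omega, by omega⟩) (Or.inl rfl) hA using 1
      rw [skip, if_neg (by omega)]
      congr
      omega
    · convert PreTree.addLeaf_mem_treeSetFull (q := k) (x := k + 1)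
        (Finset.mem_Icc.2 ⟨by omega, by omega⟩) (Or.inr rfl) hA using 1
      rw [skip, if_pos (by omega)]
    · convert PreTree.addLeaf_mem_treeSetFull (q := k) (x := k)
        (Finset.mem_Icc.2 ⟨by omega, by omega⟩) (Or.inl rfl) hA using 1
      rw [skip, if_pos (by omega)]
end

section
/- Shuffle lemma for tree stacking: let P ∈ 𝒜(p;v), Q ∈ 𝒜(q;w), R ∈ 𝒜(r;l), let i ∈ {1,…,p}, set A = P ≺_i Q, and let j ∈ {1,…,p+q−1}. (1) If j ∈ I(P;A) and j ∉ I(Q;A) (the j-th leaf of A stems from P alone), then (P ≺_i Q) ≺_j R = (P ≺_{j'} R) ≺_{i'} Q, where j' is the index in P of the leaf of P corresponding to the j-th leaf of A, and i' is the index in P ≺_{j'} R of the leaf corresponding to the i-th leaf of P. (2) If j ∈ I(Q;A) (the j-th leaf of A stems from Q), then (P ≺_i Q) ≺_j R = P ≺_i (Q ≺_{j''} R), where j'' is the index in Q of the leaf of Q corresponding to the j-th leaf of A. -/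
open scoped BigOperators

/-- Every string of `P ≺ₖ Q` is either a relabelled string of `P` or a relabelled non-trunk
string of `Q`. -/
lemma exists_eq_embP_or {k m s : ℕ} (hk : 1 ≤ k) (hs : 1 ≤ s ∧ s ≤ m) (x : ℕ) :
    (∃ y, x = embP k m s y) ∨ ∃ y, 1 ≤ y ∧ y ≤ m ∧ y ≠ s ∧ x = k + y - 1 := by
  by_cases hx : k ≤ x ∧ x ≤ k + m - 1 ∧ x ≠ k + s - 1
  · exact Or.inr ⟨x - k + 1, by omega⟩
  · refine Or.inl ⟨invP k m s x, ?_⟩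
    unfold embP invP
    split_ifs <;> omega

lemma invP_embP {k m s : ℕ} (hk : 1 ≤ k) (hs : 1 ≤ s ∧ s ≤ m) (y : ℕ) :
    invP k m s (embP k m s y) = y := by
  unfold embP invP
  split_ifs <;> omega

lemma embP_injective {k m s : ℕ} (hk : 1 ≤ k) (hs : 1 ≤ s ∧ s ≤ m) :
    Function.Injective (embP k m s) :=
  Function.LeftInverse.injective (invP_embP hk hs)

lemma embP_not_interior {k m s : ℕ} (hk : 1 ≤ k) (hs : 1 ≤ s ∧ s ≤ m) (y : ℕ) :
    ¬ (k ≤ embP k m s y ∧ embP k m s y ≤ k + m - 1 ∧ embP k m s y ≠ k + s - 1) := by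
  unfold embP
  split_ifs <;> omega

lemma stack_par_embP {k m s : ℕ} (hk : 1 ≤ k) (hs : 1 ≤ s ∧ s ≤ m) (P Q : PreTree) (y : ℕ) :
    (stack k m s P Q).par (embP k m s y) = embP k m s (P.par y) := by
  simp only [stack, if_neg (embP_not_interior hk hs y), invP_embP hk hs]

lemma stack_rk_embP {k m s : ℕ} (hk : 1 ≤ k) (hs : 1 ≤ s ∧ s ≤ m) (P Q : PreTree) (y : ℕ) :
    (stack k m s P Q).rk (embP k m s y) =
      if P.par y = k ∧ y ≠ k then P.rk y + qcount m s Q else P.rk y := by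
  simp only [stack, if_neg (embP_not_interior hk hs y), invP_embP hk hs]

lemma stack_par_of_ne {k m s y : ℕ} (hk : 1 ≤ k) (P Q : PreTree)
    (h1 : 1 ≤ y) (h2 : y ≤ m) (h3 : y ≠ s) :
    (stack k m s P Q).par (k + y - 1) = k + Q.par y - 1 := by
  have hy : k + y - 1 - k + 1 = y := by omega
  have hc : k ≤ k + y - 1 ∧ k + y - 1 ≤ k + m - 1 ∧ k + y - 1 ≠ k + s - 1 := by omega
  simp only [stack, if_pos hc, hy]

lemma stack_rk_of_ne {k m s y : ℕ} (hk : 1 ≤ k) (P Q : PreTree)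
    (h1 : 1 ≤ y) (h2 : y ≤ m) (h3 : y ≠ s) :
    (stack k m s P Q).rk (k + y - 1) = Q.rk y := by
  have hy : k + y - 1 - k + 1 = y := by omega
  have hc : k ≤ k + y - 1 ∧ k + y - 1 ≤ k + m - 1 ∧ k + y - 1 ≠ k + s - 1 := by omega
  simp only [stack, if_pos hc, hy]

lemma par_mem_of_mem_treeSetFull {n t : ℕ} {P : PreTree} (hP : P ∈ TreeSetFull n t) (y : ℕ)
    (h1 : 1 ≤ y) (h2 : y ≤ n) : 1 ≤ P.par y ∧ P.par y ≤ n := by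
  by_cases hy : y ∈ (Finset.Icc 1 n).erase t
  · exact Finset.mem_Icc.1 (hP.1.1 y hy).1
  · rw [(hP.1.2.2 y hy).1]
    exact ⟨h1, h2⟩

lemma stackTrunk_eq_embP (w k r l : ℕ) : stackTrunk w k r l = embP k r l w := by
  unfold stackTrunk embP
  split_ifs <;> omega

/-- The heads on the trunk of `Q ≺ₖ R` are those on the trunk of `Q`, together with those on the
trunk of `R` when `R` is stacked onto the trunk of `Q`. -/
lemma qcount_stack {q w r l k : ℕ} {Q R : PreTree} (hR : R ∈ TreeSetFull r l)
    (hl : 1 ≤ l ∧ l ≤ r) (hk : 1 ≤ k ∧ k ≤ q) :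
    qcount (q + r - 1) (stackTrunk w k r l) (stack k r l Q R) =
      qcount q w Q + if k = w then qcount r l R else 0 := by
  have hinj := embP_injective hk.1 hl
  have hinj' : Function.Injective fun y => k + y - 1 := fun a b h => by
    have := hk.1
    dsimp only at h
    omega
  have key : ∀ y, 1 ≤ y → y ≤ r → (k + R.par y - 1 = embP k r l w ↔ k = w ∧ R.par y = l) := by
    intro y h1 h2
    have := par_mem_of_mem_treeSetFull hR y h1 h2
    unfold embP
    split_ifs <;> omega
  have hrange : ∀ y, 1 ≤ embP k r l y ∧ embP k r l y ≤ q + r - 1 ↔ 1 ≤ y ∧ y ≤ q := by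
    intro y
    unfold embP
    split_ifs <;> omega
  have hset : (((Finset.Icc 1 (q + r - 1)).erase (embP k r l w)).filter
        fun x => (stack k r l Q R).par x = embP k r l w) =
      (((Finset.Icc 1 q).erase w).filter fun y => Q.par y = w).image (embP k r l) ∪
      (((Finset.Icc 1 r).erase l).filter fun y => k = w ∧ R.par y = l).image
        fun y => k + y - 1 := by
    ext x
    simp only [Finset.mem_union, Finset.mem_image, Finset.mem_filter, Finset.mem_erase,
      Finset.mem_Icc]
    constructor
    · rintro ⟨⟨hne, hx⟩, hpar⟩
      rcases exists_eq_embP_or hk.1 hl x with ⟨y, rfl⟩ | ⟨y, h1, h2, h3, rfl⟩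
      · rw [stack_par_embP hk.1 hl] at hpar
        exact Or.inl ⟨y, ⟨⟨fun h => hne (h ▸ rfl), (hrange y).1 hx⟩, hinj hpar⟩, rfl⟩
      · rw [stack_par_of_ne hk.1 Q R h1 h2 h3] at hpar
        exact Or.inr ⟨y, ⟨⟨h3, h1, h2⟩, (key y h1 h2).1 hpar⟩, rfl⟩
    · rintro (⟨y, ⟨⟨hne, hy⟩, hpar⟩, rfl⟩ | ⟨y, ⟨⟨h3, h1, h2⟩, hpar⟩, rfl⟩)
      · refine ⟨⟨fun h => hne (hinj h), (hrange y).2 hy⟩, ?_⟩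
        rw [stack_par_embP hk.1 hl, hpar]
      · refine ⟨⟨fun h => embP_not_interior hk.1 hl w ?_, by omega⟩, ?_⟩
        · rw [← h]
          omega
        · rw [stack_par_of_ne hk.1 Q R h1 h2 h3]
          exact (key y h1 h2).2 hpar
  have hdisj : Disjoint
      ((((Finset.Icc 1 q).erase w).filter fun y => Q.par y = w).image (embP k r l))
      ((((Finset.Icc 1 r).erase l).filter fun y => k = w ∧ R.par y = l).image
        fun y => k + y - 1) := by
    rw [Finset.disjoint_left]
    simp only [Finset.mem_image, Finset.mem_filter, Finset.mem_erase, Finset.mem_Icc]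
    rintro _ ⟨y, -, rfl⟩ ⟨z, ⟨⟨h3, h1, h2⟩, -⟩, h⟩
    refine embP_not_interior hk.1 hl y ?_
    rw [← h]
    omega
  unfold qcount
  rw [stackTrunk_eq_embP, hset, Finset.card_union_of_disjoint hdisj,
    Finset.card_image_of_injective _ hinj, Finset.card_image_of_injective _ hinj']
  by_cases hkw : k = w <;> simp [hkw]

lemma PreTree.eq_of_par_of_rk {A B : PreTree} (hpar : ∀ x, A.par x = B.par x)
    (hrk : ∀ x, A.rk x = B.rk x) : A = B := by
  cases A
  cases B
  congr
  · exact funext hpar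
  · exact funext hrk

/-- Stacking onto two different leaves of `P` can be done in either order. -/
lemma stack_stack_comm {i j q r w l : ℕ} {P Q R : PreTree} (hij : i < j) (hi : 1 ≤ i)
    (hw : 1 ≤ w ∧ w ≤ q) (hl : 1 ≤ l ∧ l ≤ r)
    (hQ : ∀ y, 1 ≤ y → y ≤ q → 1 ≤ Q.par y ∧ Q.par y ≤ q)
    (hR : ∀ y, 1 ≤ y → y ≤ r → 1 ≤ R.par y ∧ R.par y ≤ r) :
    stack (j + q - 1) r l (stack i q w P Q) R = stack i q w (stack j r l P R) Q := by
  have hj : 1 ≤ j := by omega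
  have hj' : 1 ≤ j + q - 1 := by omega
  have hPP : ∀ y, embP (j + q - 1) r l (embP i q w y) = embP i q w (embP j r l y) := by
    intro y
    unfold embP
    split_ifs <;> omega
  have hPQ : ∀ y, 1 ≤ y → y ≤ q → embP (j + q - 1) r l (i + y - 1) = i + y - 1 := by
    intro y h1 h2
    unfold embP
    split_ifs <;> omega
  have hPR : ∀ y, 1 ≤ y → y ≤ r → embP i q w (j + y - 1) = j + q - 1 + y - 1 := by
    intro y h1 h2
    unfold embP
    split_ifs <;> omega
  have hi_iff : ∀ y, embP j r l y = i ↔ y = i := by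
    intro y
    unfold embP
    split_ifs <;> omega
  have hj_iff : ∀ y, embP i q w y = j + q - 1 ↔ y = j := by
    intro y
    unfold embP
    split_ifs <;> omega
  have hx : ∀ x, (stack (j + q - 1) r l (stack i q w P Q) R).par x =
        (stack i q w (stack j r l P R) Q).par x ∧
      (stack (j + q - 1) r l (stack i q w P Q) R).rk x =
        (stack i q w (stack j r l P R) Q).rk x := by
    intro x
    rcases exists_eq_embP_or hj' hl x with ⟨y, rfl⟩ | ⟨y, h1, h2, h3, rfl⟩
    · rcases exists_eq_embP_or hi hw y with ⟨y, rfl⟩ | ⟨y, h1, h2, h3, rfl⟩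
      · rw [stack_par_embP hj' hl, stack_par_embP hi hw, stack_rk_embP hj' hl,
          stack_par_embP hi hw, stack_rk_embP hi hw, hPP, hPP,
          stack_par_embP hi hw, stack_par_embP hj hl, stack_rk_embP hi hw,
          stack_par_embP hj hl, stack_rk_embP hj hl]
        simp only [ne_eq, hi_iff, hj_iff, true_and]
        split_ifs <;> omega
      · have := hQ y h1 h2
        rw [stack_par_embP hj' hl, stack_rk_embP hj' hl, stack_par_of_ne hi P Q h1 h2 h3,
          stack_rk_of_ne hi P Q h1 h2 h3, hPQ y h1 h2, hPQ _ this.1 this.2,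
          stack_par_of_ne hi _ Q h1 h2 h3, stack_rk_of_ne hi _ Q h1 h2 h3, if_neg (by omega)]
        exact ⟨rfl, rfl⟩
    · have := hR y h1 h2
      rw [stack_par_of_ne hj' _ R h1 h2 h3, stack_rk_of_ne hj' _ R h1 h2 h3, ← hPR y h1 h2,
        ← hPR _ this.1 this.2, stack_par_embP hi hw, stack_rk_embP hi hw,
        stack_par_of_ne hj P R h1 h2 h3, stack_rk_of_ne hj P R h1 h2 h3, if_neg (by omega)]
      exact ⟨rfl, rfl⟩
  exact PreTree.eq_of_par_of_rk (fun x => (hx x).1) fun x => (hx x).2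

/-- Stacking `R` onto a leaf of `P ≺ᵢ Q` stemming from `Q` is the same as stacking it onto `Q`
first. -/
lemma stack_stack_assoc {i k q r w l : ℕ} {P Q R : PreTree} (hi : 1 ≤ i)
    (hk : 1 ≤ k ∧ k ≤ q) (hw : 1 ≤ w ∧ w ≤ q) (hl : 1 ≤ l ∧ l ≤ r)
    (hQ : Q ∈ TreeSetFull q w) (hR : R ∈ TreeSetFull r l) :
    stack (i + k - 1) r l (stack i q w P Q) R =
      stack i (q + r - 1) (stackTrunk w k r l) P (stack k r l Q R) := by
  have hk' : 1 ≤ i + k - 1 := by omega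
  have hcount := qcount_stack (w := w) (Q := Q) hR hl hk
  rw [stackTrunk_eq_embP] at hcount ⊢
  have hrange : ∀ y, 1 ≤ y → y ≤ q → 1 ≤ embP k r l y ∧ embP k r l y ≤ q + r - 1 := by
    intro y h1 h2
    unfold embP
    split_ifs <;> omega
  have hw' := hrange w hw.1 hw.2
  have hPP : ∀ y, embP (i + k - 1) r l (embP i q w y) =
      embP i (q + r - 1) (embP k r l w) y := by
    intro y
    unfold embP
    split_ifs <;> omega
  have hPQ : ∀ y, 1 ≤ y → embP (i + k - 1) r l (i + y - 1) = i + embP k r l y - 1 := by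
    intro y h1
    unfold embP
    split_ifs <;> omega
  have hk_iff : ∀ y, embP i q w y = i + k - 1 ↔ y = i ∧ k = w := by
    intro y
    unfold embP
    split_ifs <;> omega
  have hx : ∀ x, (stack (i + k - 1) r l (stack i q w P Q) R).par x =
        (stack i (q + r - 1) (embP k r l w) P (stack k r l Q R)).par x ∧
      (stack (i + k - 1) r l (stack i q w P Q) R).rk x =
        (stack i (q + r - 1) (embP k r l w) P (stack k r l Q R)).rk x := by
    intro x
    rcases exists_eq_embP_or hk' hl x with ⟨y, rfl⟩ | ⟨y, h1, h2, h3, rfl⟩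
    · rcases exists_eq_embP_or hi hw y with ⟨y, rfl⟩ | ⟨y, h1, h2, h3, rfl⟩
      · rw [stack_par_embP hk' hl, stack_par_embP hi hw, stack_rk_embP hk' hl,
          stack_par_embP hi hw, stack_rk_embP hi hw, hPP, hPP,
          stack_par_embP hi hw', stack_rk_embP hi hw', hcount]
        simp only [ne_eq, hk_iff, true_and]
        split_ifs <;> omega
      · have hpar := par_mem_of_mem_treeSetFull hQ y h1 h2
        have hy := hrange y h1 h2
        have hne : embP k r l y ≠ embP k r l w := (embP_injective hk.1 hl).ne h3
        rw [stack_par_embP hk' hl, stack_rk_embP hk' hl, stack_par_of_ne hi P Q h1 h2 h3,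
          stack_rk_of_ne hi P Q h1 h2 h3, hPQ y h1, hPQ _ hpar.1,
          stack_par_of_ne hi P _ hy.1 hy.2 hne, stack_rk_of_ne hi P _ hy.1 hy.2 hne,
          stack_par_embP hk.1 hl, stack_rk_embP hk.1 hl]
        refine ⟨rfl, ?_⟩
        split_ifs <;> omega
    · have hpar := par_mem_of_mem_treeSetFull hR y h1 h2
      have hne : k + y - 1 ≠ embP k r l w := by
        unfold embP
        split_ifs <;> omega
      have hy : i + k - 1 + y - 1 = i + (k + y - 1) - 1 := by omega
      rw [stack_par_of_ne hk' _ R h1 h2 h3, stack_rk_of_ne hk' _ R h1 h2 h3, hy,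
        stack_par_of_ne hi P _ (by omega) (by omega) hne,
        stack_rk_of_ne hi P _ (by omega) (by omega) hne,
        stack_par_of_ne hk.1 Q R h1 h2 h3, stack_rk_of_ne hk.1 Q R h1 h2 h3]
      exact ⟨by omega, rfl⟩
  exact PreTree.eq_of_par_of_rk (fun x => (hx x).1) fun x => (hx x).2

/-- **Shuffle lemma for tree stacking.**  Let `P ∈ 𝒜(p;v)`, `Q ∈ 𝒜(q;w)`,
`R ∈ 𝒜(r;l)`, `i ∈ {1,…,p}`, `A = P ≺ᵢ Q`, and `j ∈ {1,…,p+q-1}`.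
(1) If the `j`-th leaf of `A` stems from `P` alone (i.e. `j < i` or
`j ≥ i + q`), then `(P ≺ᵢ Q) ≺ⱼ R = (P ≺_{j'} R) ≺_{i'} Q`, where `j'` is the
index in `P` of the leaf corresponding to the `j`-th leaf of `A` and `i'` is
the index in `P ≺_{j'} R` of the leaf corresponding to the `i`-th leaf of `P`.
(2) If the `j`-th leaf of `A` stems from `Q` (i.e. `i ≤ j ≤ i + q - 1`), then
`(P ≺ᵢ Q) ≺ⱼ R = P ≺ᵢ (Q ≺_{j''} R)` with `j'' = j - i + 1`. -/
theorem stack_shuffle (p q r v w l : ℕ) (P Q R : PreTree)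
    (hP : P ∈ TreeSetFull p v) (hQ : Q ∈ TreeSetFull q w)
    (hR : R ∈ TreeSetFull r l)
    (hv : 1 ≤ v ∧ v ≤ p) (hw : 1 ≤ w ∧ w ≤ q) (hl : 1 ≤ l ∧ l ≤ r)
    (i : ℕ) (hi : 1 ≤ i ∧ i ≤ p) (j : ℕ) (hj : 1 ≤ j ∧ j ≤ p + q - 1) :
    ((j < i ∨ i + q ≤ j) →
      stack j r l (stack i q w P Q) R =
        stack (if j < i then i + r - 1 else i) q w
          (stack (if j < i then j else j - (q - 1)) r l P R) Q) ∧
    (i ≤ j ∧ j ≤ i + q - 1 →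
      stack j r l (stack i q w P Q) R =
        stack i (q + r - 1) (stackTrunk w (j - i + 1) r l) P
          (stack (j - i + 1) r l Q R)) := by
  have hQ' := par_mem_of_mem_treeSetFull hQ
  have hR' := par_mem_of_mem_treeSetFull hR
  refine ⟨fun h => ?_, fun h => ?_⟩
  · by_cases hji : j < i
    · rw [if_pos hji, if_pos hji]
      exact (stack_stack_comm hji hj.1 hl hw hR' hQ').symm
    · rw [if_neg hji, if_neg hji]
      have := stack_stack_comm (P := P) (i := i) (j := j - (q - 1)) (by omega) hi.1 hw hl hQ' hR'
      rwa [show j - (q - 1) + q - 1 = j by omega] at this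
  · have := stack_stack_assoc (P := P) (k := j - i + 1) hi.1 (by omega) hw hl hQ hR
    rwa [show i + (j - i + 1) - 1 = j by omega] at this
end

section
/- Decomposition of a planar tree diagram with respect to an arrow: for any A ∈ 𝒜(n;t) and any arrow α of A with head on string i and tail on string j, there exist planar tree diagrams P, R, S (each possibly empty) with numbers of leaves p, r, s satisfying n = p + r + s − 1 (an empty diagram counting as one leaf), such that A = P ≺_v Q, where v is the index in P of the leaf corresponding to string i of A, and Q = (e ≺₂ R) ≺₁ S if i < j, while Q = (ē ≺₂ R) ≺₁ S if i > j, the elementary tree e (respectively ē) corresponding to the arrow α of A. -/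
open scoped BigOperators

/-- A height function witnessing planarity of a tree diagram on the strings `1,…,n`, in which the
trunk is placed below all the arrows. -/
structure IsHeight (n t : ℕ) (A : PreTree) (h : ℕ → ℚ) : Prop where
  inj : ∀ i i', 1 ≤ i → i ≤ n → i ≠ t → 1 ≤ i' → i' ≤ n → i' ≠ t → h i = h i' → i = i'
  rk_iff : ∀ i i', 1 ≤ i → i ≤ n → i ≠ t → 1 ≤ i' → i' ≤ n → i' ≠ t → A.par i = A.par i' →
    (A.rk i < A.rk i' ↔ h i < h i')
  lt_par : ∀ i, 1 ≤ i → i ≤ n → i ≠ t → h i < h (A.par i)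
  lt_trunk : ∀ i, 1 ≤ i → i ≤ n → i ≠ t → h i < h t
  lt_of_between : ∀ i, 1 ≤ i → i ≤ n → i ≠ t → ∀ k, 1 ≤ k → k ≤ n →
    min (A.par i) i < k → k < max (A.par i) i → h k < h i

lemma mem_erase_Icc {n t i : ℕ} : i ∈ (Finset.Icc 1 n).erase t ↔ i ≠ t ∧ 1 ≤ i ∧ i ≤ n := by
  simp

lemma PreTree.IsPlanar.exists_isHeight {n t : ℕ} {A : PreTree}
    (hT : A.IsTreeDiagram (Finset.Icc 1 n) t) (hP : A.IsPlanar (Finset.Icc 1 n) t) :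
    ∃ h, IsHeight n t A h := by
  obtain ⟨h, h1, h2, h3, h4⟩ := hP
  obtain ⟨M, hM⟩ := ((Finset.Icc 1 n).image h).exists_le
  have hM' : ∀ i, 1 ≤ i → i ≤ n → h i < M + 1 := fun i hi hi' => by
    have := hM (h i) (Finset.mem_image_of_mem _ (Finset.mem_Icc.2 ⟨hi, hi'⟩))
    linarith
  refine ⟨fun i => if i = t then M + 1 else h i, ?_, ?_, ?_, ?_, ?_⟩
  · intro i i' a b c a' b' c'
    simp only [c, c', if_false]
    exact h1 i (mem_erase_Icc.2 ⟨c, a, b⟩) i' (mem_erase_Icc.2 ⟨c', a', b'⟩)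
  · intro i i' a b c a' b' c'
    simp only [c, c', if_false]
    exact h2 i (mem_erase_Icc.2 ⟨c, a, b⟩) i' (mem_erase_Icc.2 ⟨c', a', b'⟩)
  · intro i a b c
    have hi := mem_erase_Icc.2 ⟨c, a, b⟩
    simp only [c, if_false]
    split_ifs with hp
    · exact hM' i a b
    · exact h3 i hi _ (Finset.mem_erase.2 ⟨hp, (hT.1 i hi).1⟩) rfl
  · intro i a b c
    simp only [c, if_false, if_true]
    exact hM' i a b
  · intro i a b c k hk hk' hlt hgt
    obtain ⟨u, v⟩ := h4 i (mem_erase_Icc.2 ⟨c, a, b⟩) k (Finset.mem_Icc.2 ⟨hk, hk'⟩) hlt hgt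
    simpa only [c, u, if_false] using v

lemma IsHeight.isPlanar {n t : ℕ} {A : PreTree} {h : ℕ → ℚ} (hh : IsHeight n t A h) :
    A.IsPlanar (Finset.Icc 1 n) t := by
  simp only [PreTree.IsPlanar, mem_erase_Icc, Finset.mem_Icc]
  refine ⟨h, fun i hi i' hi' => hh.inj i i' hi.2.1 hi.2.2 hi.1 hi'.2.1 hi'.2.2 hi'.1,
    fun i hi i' hi' => hh.rk_iff i i' hi.2.1 hi.2.2 hi.1 hi'.2.1 hi'.2.2 hi'.1,
    fun i hi i' _ e => e ▸ hh.lt_par i hi.2.1 hi.2.2 hi.1, fun i hi k hk hlt hgt => ?_⟩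
  have := hh.lt_of_between i hi.2.1 hi.2.2 hi.1 k hk.1 hk.2 hlt hgt
  refine ⟨?_, this⟩
  rintro rfl
  exact lt_asymm this (hh.lt_trunk i hi.2.1 hi.2.2 hi.1)

/-- A set of strings closed under taking parents, except at its root `b`, lies above `b`. -/
lemma IsHeight.lt_root {n t b : ℕ} {A : PreTree} {h : ℕ → ℚ} (hh : IsHeight n t A h)
    {J : Finset ℕ} (hJ : ∀ i ∈ J, 1 ≤ i ∧ i ≤ n) (ht : t ∈ J → t = b)
    (hclosed : ∀ i ∈ J, i ≠ b → A.par i ∈ J) :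
    ∀ i ∈ J, i ≠ b → h i < h b := by
  intro i hi hib
  obtain ⟨x, hx, hmax⟩ := (J.erase b).exists_max_image h ⟨i, Finset.mem_erase.2 ⟨hib, hi⟩⟩
  obtain ⟨hxb, hxJ⟩ := Finset.mem_erase.1 hx
  have hlt := hh.lt_par x (hJ x hxJ).1 (hJ x hxJ).2 (by rintro rfl; exact hxb (ht hxJ))
  have hix := hmax i (Finset.mem_erase.2 ⟨hib, hi⟩)
  by_cases hp : A.par x = b
  · rw [hp] at hlt
    exact hix.trans_lt hlt
  · exact absurd (hmax _ (Finset.mem_erase.2 ⟨hp, hclosed x hxJ hxb⟩)) (not_le.2 hlt)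

lemma IsHeight.mem_of_between {n t b : ℕ} {A : PreTree} {h : ℕ → ℚ} (hh : IsHeight n t A h)
    (hT : A.IsTreeDiagram (Finset.Icc 1 n) t)
    {J : Finset ℕ} (hJ : ∀ i ∈ J, 1 ≤ i ∧ i ≤ n) (ht : t ∈ J → t = b) (hb : b ∈ J)
    (hclosed : ∀ i ∈ J, i ≠ b → A.par i ∈ J)
    (houter : ∀ y, 1 ≤ y → y ≤ n → y ≠ t → y ∉ J →
      A.par y ∉ J ∨ (A.par y = b ∧ ∀ i ∈ J, i ≠ b → h i < h y)) :
    ∀ x ∈ J, ∀ z ∈ J, ∀ y, x < y → y < z → y ∈ J := by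
  have hroot := hh.lt_root hJ ht hclosed
  have key : ∀ x ∈ J, ∀ y, min x b < y → y < max x b → y ∈ J := by
    by_contra! hcon
    obtain ⟨x, hx, y, hxy, hyx, hy⟩ := hcon
    let B := (J ×ˢ Finset.Icc 1 n).filter
      fun p => p.2 ∉ J ∧ min p.1 b < p.2 ∧ p.2 < max p.1 b
    have memB : ∀ x y, (x, y) ∈ B ↔ (x ∈ J ∧ 1 ≤ y ∧ y ≤ n) ∧ y ∉ J ∧
        min x b < y ∧ y < max x b := by
      intro x y
      simp only [B, Finset.mem_filter, Finset.mem_product, Finset.mem_Icc]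
    have hne : B.Nonempty := ⟨(x, y), (memB x y).2
      ⟨⟨hx, by have := hJ x hx; have := hJ b hb; omega⟩, hy, hxy, hyx⟩⟩
    obtain ⟨⟨x, y⟩, hB, hmax⟩ := B.exists_max_image (fun p => h p.1 + h p.2) hne
    obtain ⟨⟨hx, hy1, hyn⟩, hy, hxy, hyx⟩ := (memB x y).1 hB
    have hxr := hJ x hx
    have hbr := hJ b hb
    have hxb : x ≠ b := by rintro rfl; omega
    have hxt : x ≠ t := by rintro rfl; exact hxb (ht hx)
    have hxh := hroot x hx hxb
    rcases lt_trichotomy (h x) (h y) with hlt | heq | hgt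
    · have hpx := hclosed x hx hxb
      have hpy : A.par x ≠ y := fun e => hy (e ▸ hpx)
      by_cases hbet : min (A.par x) x < y ∧ y < max (A.par x) x
      · exact lt_asymm hlt (hh.lt_of_between x hxr.1 hxr.2 hxt y hy1 hyn hbet.1 hbet.2)
      · have := hmax (A.par x, y) ((memB _ _).2 ⟨⟨hpx, hy1, hyn⟩, hy, by omega, by omega⟩)
        have h1 := hh.lt_par x hxr.1 hxr.2 hxt
        simp only at this
        linarith
    · have hyt : y ≠ t := by
        rintro rfl
        exact (hh.lt_trunk x hxr.1 hxr.2 hxt).ne heq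
      exact hy (hh.inj x y hxr.1 hxr.2 hxt hy1 hyn hyt heq ▸ hx)
    · have hyt : y ≠ t := by
        rintro rfl
        exact lt_asymm (hh.lt_trunk x hxr.1 hxr.2 hxt) hgt
      have hpr := Finset.mem_Icc.1 (hT.1 y (mem_erase_Icc.2 ⟨hyt, hy1, hyn⟩)).1
      rcases houter y hy1 hyn hyt hy with hp | ⟨-, hp⟩
      · have hpx : A.par y ≠ x := fun e => hp (e ▸ hx)
        have hpb : A.par y ≠ b := fun e => hp (e ▸ hb)
        by_cases h1 : min (A.par y) y < x ∧ x < max (A.par y) y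
        · exact lt_asymm hgt (hh.lt_of_between y hy1 hyn hyt x hxr.1 hxr.2 h1.1 h1.2)
        by_cases h2 : min (A.par y) y < b ∧ b < max (A.par y) y
        · have := hh.lt_of_between y hy1 hyn hyt b hbr.1 hbr.2 h2.1 h2.2
          linarith
        have := hmax (x, A.par y) ((memB _ _).2 ⟨⟨hx, hpr⟩, hp, by omega, by omega⟩)
        have h3 := hh.lt_par y hy1 hyn hyt
        simp only at this
        linarith
      · exact lt_asymm hgt (hp x hx hxb)
  intro x hx z hz y hxy hyz
  rcases lt_trichotomy y b with hlt | rfl | hgt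
  · exact key x hx y (by omega) (by omega)
  · exact hb
  · exact key z hz y (by omega) (by omega)

lemma rank_lt_card_of_initial {C D : Finset ℕ} (f : ℕ → ℕ) (hDC : D ⊆ C)
    (hinj : ∀ i ∈ C, ∀ i' ∈ C, f i = f i' → i = i') (hlt : ∀ i ∈ C, f i < C.card)
    (hinit : ∀ i ∈ D, ∀ i' ∈ C, i' ∉ D → f i < f i') {i : ℕ} (hi : i ∈ D) :
    f i < D.card := by
  have himg : C.image f = Finset.range C.card := by
    apply Finset.eq_of_subset_of_card_le
    · intro x hx
      obtain ⟨y, hy, rfl⟩ := Finset.mem_image.1 hx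
      exact Finset.mem_range.2 (hlt y hy)
    · rw [Finset.card_range, Finset.card_image_of_injOn (fun x hx y hy e => hinj x hx y hy e)]
  have hsub : Finset.range (f i + 1) ⊆ D.image f := by
    intro x hx
    have hx' := Finset.mem_range.1 hx
    have hxC : x ∈ C.image f := by
      rw [himg, Finset.mem_range]
      have := hlt i (hDC hi)
      omega
    obtain ⟨y, hy, rfl⟩ := Finset.mem_image.1 hxC
    refine Finset.mem_image_of_mem _ ?_
    by_contra hyD
    have := hinit i hi y hy hyD
    omega
  have := (Finset.card_le_card hsub).trans Finset.card_image_le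
  rw [Finset.card_range] at this
  omega

lemma card_le_rank_of_initial {C D : Finset ℕ} (f : ℕ → ℕ) (hDC : D ⊆ C)
    (hinj : ∀ i ∈ C, ∀ i' ∈ C, f i = f i' → i = i')
    (hinit : ∀ i ∈ D, ∀ i' ∈ C, i' ∉ D → f i < f i') {i : ℕ} (hi : i ∈ C) (hiD : i ∉ D) :
    D.card ≤ f i := by
  have hsub : D.image f ⊆ Finset.range (f i) := by
    intro x hx
    obtain ⟨y, hy, rfl⟩ := Finset.mem_image.1 hx
    exact Finset.mem_range.2 (hinit y hy i hi hiD)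
  have := Finset.card_le_card hsub
  rwa [Finset.card_range,
    Finset.card_image_of_injOn (fun x hx y hy e => hinj x (hDC hx) y (hDC hy) e)] at this

/-- The strings `k,…,k+m-1` of the tree diagram `A` (on the strings `1,…,n`, trunk `t`) form a
diagram with trunk `k+s-1` which can be cut off: it is only attached to the rest of `A` through
the string `k+s-1`, on which its arrowheads are the topmost ones. -/
structure IsCut (n t k m s : ℕ) (A : PreTree) : Prop where
  one_le_k : 1 ≤ k
  one_le_s : 1 ≤ s
  s_le : s ≤ m
  le_n : k + m ≤ n + 1
  trunk : k ≤ t → t < k + m → t = k + s - 1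
  closed : ∀ i, k ≤ i → i < k + m → i ≠ k + s - 1 → k ≤ A.par i ∧ A.par i < k + m
  outer : ∀ i, 1 ≤ i → i ≤ n → i ≠ t → i < k ∨ k + m ≤ i →
    A.par i < k ∨ k + m ≤ A.par i ∨ A.par i = k + s - 1
  rk_lt : ∀ i i', k ≤ i → i < k + m → i ≠ k + s - 1 → A.par i = k + s - 1 →
    1 ≤ i' → i' ≤ n → i' ≠ t → i' < k ∨ k + m ≤ i' → A.par i' = k + s - 1 → A.rk i < A.rk i'

/-- The part of `A` on the strings `k,…,k+m-1`, relabelled by `1,…,m`. -/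
def cutUpper (k m s : ℕ) (A : PreTree) : PreTree where
  par q := if 1 ≤ q ∧ q ≤ m ∧ q ≠ s then A.par (q + k - 1) + 1 - k else q
  rk q := if 1 ≤ q ∧ q ≤ m ∧ q ≠ s then A.rk (q + k - 1) else 0

/-- The tree diagram obtained from `A` by contracting the strings `k,…,k+m-1` to one string. -/
def cutLower (n t k m s : ℕ) (A : PreTree) : PreTree where
  par p := if 1 ≤ p ∧ p ≤ n + 1 - m ∧ embP k m s p ≠ t then
    invP k m s (A.par (embP k m s p)) else p
  rk p := if 1 ≤ p ∧ p ≤ n + 1 - m ∧ embP k m s p ≠ t then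
    A.rk (embP k m s p) -
      (if A.par (embP k m s p) = k + s - 1 then qcount m s (cutUpper k m s A) else 0) else 0

/-- The strings whose arrow has its head on the string `b`. -/
def children (n t : ℕ) (A : PreTree) (b : ℕ) : Finset ℕ :=
  ((Finset.Icc 1 n).erase t).filter fun i => A.par i = b

lemma mem_children {n t b i : ℕ} {A : PreTree} :
    i ∈ children n t A b ↔ (i ≠ t ∧ 1 ≤ i ∧ i ≤ n) ∧ A.par i = b := by
  simp [children]

namespace IsCut

variable {n t k m s : ℕ} {A : PreTree}

lemma embP_invP (hc : IsCut n t k m s A) {i : ℕ} (hi : i < k ∨ k + m ≤ i ∨ i = k + s - 1) :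
    embP k m s (invP k m s i) = i := by
  have := hc.one_le_k; have := hc.one_le_s; have := hc.s_le
  unfold embP invP
  split_ifs <;> omega

lemma embP_out (hc : IsCut n t k m s A) (p : ℕ) :
    embP k m s p < k ∨ k + m ≤ embP k m s p ∨ embP k m s p = k + s - 1 := by
  have := hc.one_le_k; have := hc.one_le_s; have := hc.s_le
  unfold embP
  split_ifs <;> omega

lemma embP_mem (hc : IsCut n t k m s A) {p : ℕ} (h1 : 1 ≤ p) (h2 : p ≤ n + 1 - m) :
    1 ≤ embP k m s p ∧ embP k m s p ≤ n := by
  have := hc.one_le_k; have := hc.one_le_s; have := hc.s_le; have := hc.le_n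
  unfold embP
  split_ifs <;> omega

lemma invP_mem (hc : IsCut n t k m s A) {i : ℕ} (h1 : 1 ≤ i) (h2 : i ≤ n)
    (hi : i < k ∨ k + m ≤ i ∨ i = k + s - 1) :
    1 ≤ invP k m s i ∧ invP k m s i ≤ n + 1 - m := by
  have := hc.one_le_k; have := hc.one_le_s; have := hc.s_le; have := hc.le_n
  unfold invP
  split_ifs <;> omega

lemma embP_lt (hc : IsCut n t k m s A) {p q : ℕ} (h : p < q) : embP k m s p < embP k m s q := by
  have := hc.one_le_k; have := hc.one_le_s; have := hc.s_le
  unfold embP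
  split_ifs <;> omega

lemma embP_inj (hc : IsCut n t k m s A) {p q : ℕ} (h : embP k m s p = embP k m s q) : p = q := by
  rcases lt_trichotomy p q with hlt | heq | hlt
  · exact absurd h (hc.embP_lt hlt).ne
  · exact heq
  · exact absurd h (hc.embP_lt hlt).ne'

lemma invP_embP (hc : IsCut n t k m s A) (p : ℕ) : invP k m s (embP k m s p) = p :=
  hc.embP_inj (hc.embP_invP (hc.embP_out p))

lemma trunk_out (hc : IsCut n t k m s A) : t < k ∨ k + m ≤ t ∨ t = k + s - 1 := by
  have := hc.trunk
  omega

lemma lt_root (hc : IsCut n t k m s A) {h : ℕ → ℚ} (hh : IsHeight n t A h) {i : ℕ}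
    (h1 : k ≤ i) (h2 : i < k + m) (h3 : i ≠ k + s - 1) : h i < h (k + s - 1) := by
  have := hc.one_le_k; have := hc.le_n; have htr := hc.trunk
  refine hh.lt_root (J := Finset.Ico k (k + m)) (fun i hi => ?_) (fun hi => ?_)
    (fun i hi hib => ?_) i (Finset.mem_Ico.2 ⟨h1, h2⟩) h3
  · rw [Finset.mem_Ico] at hi
    omega
  · rw [Finset.mem_Ico] at hi
    omega
  · rw [Finset.mem_Ico] at hi ⊢
    exact hc.closed i hi.1 hi.2 hib

lemma par_out (hc : IsCut n t k m s A) {h : ℕ → ℚ} (hh : IsHeight n t A h) {i : ℕ}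
    (h1 : 1 ≤ i) (h2 : i ≤ n) (h3 : i ≠ t) (hi : i < k ∨ k + m ≤ i ∨ i = k + s - 1) :
    A.par i < k ∨ k + m ≤ A.par i ∨ A.par i = k + s - 1 := by
  by_cases hb : i = k + s - 1
  · by_contra! hcon
    have hlt := hc.lt_root hh hcon.1 hcon.2.1 hcon.2.2
    have := hh.lt_par i h1 h2 h3
    rw [hb] at this
    rw [hb] at hlt
    exact lt_asymm this hlt
  · exact hc.outer i h1 h2 h3 (by omega)

/-- The arrows of the part which is cut off having their head on its trunk. -/
lemma qcount_eq (hc : IsCut n t k m s A) :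
    qcount m s (cutUpper k m s A) =
      ((children n t A (k + s - 1)).filter fun i => k ≤ i ∧ i < k + m ∧ i ≠ k + s - 1).card := by
  have := hc.one_le_k; have := hc.one_le_s; have := hc.s_le; have := hc.le_n
  have htr := hc.trunk
  unfold qcount
  refine Finset.card_bij (fun q _ => q + k - 1) ?_ ?_ ?_
  · intro q hq
    rw [Finset.mem_filter, mem_erase_Icc] at hq
    simp only [cutUpper] at hq
    rw [if_pos (by omega)] at hq
    have := hc.closed (q + k - 1) (by omega) (by omega) (by omega)
    simp only [Finset.mem_filter, mem_children]
    omega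
  · intro q hq q' hq'
    simp only [Finset.mem_filter, mem_erase_Icc] at hq hq'
    omega
  · intro i hi
    simp only [Finset.mem_filter, mem_children] at hi
    refine ⟨i + 1 - k, ?_, by omega⟩
    rw [Finset.mem_filter, mem_erase_Icc]
    simp only [cutUpper]
    rw [if_pos (by omega), show i + 1 - k + k - 1 = i by omega]
    omega

lemma card_filter_le (hc : IsCut n t k m s A) (hT : A.IsTreeDiagram (Finset.Icc 1 n) t)
    {i : ℕ} (hi : i ∈ children n t A (k + s - 1)) (hi' : i < k ∨ k + m ≤ i ∨ i = k + s - 1) :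
    ((children n t A (k + s - 1)).filter
      fun i => k ≤ i ∧ i < k + m ∧ i ≠ k + s - 1).card ≤ A.rk i := by
  refine card_le_rank_of_initial (C := children n t A (k + s - 1)) A.rk
    (Finset.filter_subset _ _) ?_ ?_ hi ?_
  · intro x hx y hy e
    rw [mem_children] at hx hy
    exact hT.2.1 x (mem_erase_Icc.2 hx.1) y (mem_erase_Icc.2 hy.1) (hx.2.trans hy.2.symm) e
  · intro x hx y hy hy'
    simp only [Finset.mem_filter, mem_children] at hx hy hy'
    have hpy := (hT.1 y (mem_erase_Icc.2 hy.1)).2.1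
    exact hc.rk_lt x y hx.2.1 hx.2.2.1 hx.2.2.2 hx.1.2 hy.1.2.1 hy.1.2.2 hy.1.1 (by omega) hy.2
  · simp only [Finset.mem_filter]
    omega

lemma rk_lt_card_filter (hc : IsCut n t k m s A) (hT : A.IsTreeDiagram (Finset.Icc 1 n) t)
    {i : ℕ} (hi : i ∈ (children n t A (k + s - 1)).filter
      fun i => k ≤ i ∧ i < k + m ∧ i ≠ k + s - 1) :
    A.rk i < ((children n t A (k + s - 1)).filter
      fun i => k ≤ i ∧ i < k + m ∧ i ≠ k + s - 1).card := by
  refine rank_lt_card_of_initial (C := children n t A (k + s - 1)) A.rk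
    (Finset.filter_subset _ _) ?_ ?_ ?_ hi
  · intro x hx y hy e
    rw [mem_children] at hx hy
    exact hT.2.1 x (mem_erase_Icc.2 hx.1) y (mem_erase_Icc.2 hy.1) (hx.2.trans hy.2.symm) e
  · intro x hx
    have hx' := mem_children.1 hx
    have := (hT.1 x (mem_erase_Icc.2 hx'.1)).2.2
    rwa [hx'.2] at this
  · intro x hx y hy hy'
    simp only [Finset.mem_filter, mem_children] at hx hy hy'
    have hpy := (hT.1 y (mem_erase_Icc.2 hy.1)).2.1
    exact hc.rk_lt x y hx.2.1 hx.2.2.1 hx.2.2.2 hx.1.2 hy.1.2.1 hy.1.2.2 hy.1.1 (by omega) hy.2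

lemma eq_stack (hc : IsCut n t k m s A) (hT : A.IsTreeDiagram (Finset.Icc 1 n) t)
    {h : ℕ → ℚ} (hh : IsHeight n t A h) :
    A = stack k m s (cutLower n t k m s A) (cutUpper k m s A) := by
  have hk := hc.one_le_k; have hs1 := hc.one_le_s; have hsm := hc.s_le; have hn := hc.le_n
  have htr := hc.trunk
  have hpar : ∀ i, A.par i =
      (stack k m s (cutLower n t k m s A) (cutUpper k m s A)).par i ∧ A.rk i =
      (stack k m s (cutLower n t k m s A) (cutUpper k m s A)).rk i := by
    intro i
    by_cases hi : k ≤ i ∧ i ≤ k + m - 1 ∧ i ≠ k + s - 1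
    · have := hc.closed i (by omega) (by omega) (by omega)
      simp only [stack, if_pos hi, cutUpper]
      rw [if_pos (by omega), if_pos (by omega), show i - k + 1 + k - 1 = i by omega]
      refine ⟨?_, rfl⟩
      omega
    · have hout : i < k ∨ k + m ≤ i ∨ i = k + s - 1 := by omega
      have hemb := hc.embP_invP hout
      simp only [stack, if_neg hi, cutLower, hemb]
      by_cases hin : 1 ≤ i ∧ i ≤ n ∧ i ≠ t
      · have hinv := hc.invP_mem hin.1 hin.2.1 hout
        have hpo := hc.par_out hh hin.1 hin.2.1 hin.2.2 hout
        have hpe := hc.embP_invP hpo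
        have hcond : 1 ≤ invP k m s i ∧ invP k m s i ≤ n + 1 - m ∧ i ≠ t :=
          ⟨hinv.1, hinv.2, hin.2.2⟩
        simp only [if_pos hcond, hpe, true_and]
        have hTi := hT.1 i (mem_erase_Icc.2 ⟨hin.2.2, hin.1, hin.2.1⟩)
        have hkk : embP k m s k = k + s - 1 := by simp [embP]
        by_cases hb : A.par i = k + s - 1
        · have e1 : invP k m s (A.par i) = k := by
            rw [hb, ← hkk, hc.invP_embP]
          have e2 : invP k m s i ≠ k := by
            intro e
            rw [e, hkk] at hemb
            exact hTi.2.1 (by omega)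
          rw [if_pos ⟨e1, e2⟩, if_pos hb, hc.qcount_eq]
          have := hc.card_filter_le hT
            (mem_children.2 ⟨⟨hin.2.2, hin.1, hin.2.1⟩, hb⟩) hout
          omega
        · have e1 : invP k m s (A.par i) ≠ k := by
            intro e
            rw [e, hkk] at hpe
            exact hb hpe.symm
          rw [if_neg (fun e => e1 e.1), if_neg hb, Nat.sub_zero]
      · have hpin := hT.2.2 i (by rw [mem_erase_Icc]; omega)
        have hcond : ¬ (1 ≤ invP k m s i ∧ invP k m s i ≤ n + 1 - m ∧ i ≠ t) := by
          rintro ⟨h1, h2, h3⟩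
          have := hc.embP_mem h1 h2
          rw [hemb] at this
          exact hin ⟨this.1, this.2, h3⟩
        simp only [if_neg hcond, hemb]
        rw [if_neg (fun e => e.2 e.1)]
        exact hpin
  cases A
  simp only [PreTree.mk.injEq, stack]
  exact ⟨funext fun i => (hpar i).1, funext fun i => (hpar i).2⟩

lemma cutUpper_mem (hc : IsCut n t k m s A) (hT : A.IsTreeDiagram (Finset.Icc 1 n) t)
    {h : ℕ → ℚ} (hh : IsHeight n t A h) : cutUpper k m s A ∈ TreeSetFull m s := by
  have hk := hc.one_le_k; have hs1 := hc.one_le_s; have hsm := hc.s_le; have hn := hc.le_n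
  have htr := hc.trunk
  have hpar : ∀ q, 1 ≤ q → q ≤ m → q ≠ s →
      (cutUpper k m s A).par q + k - 1 = A.par (q + k - 1) ∧
      1 ≤ (cutUpper k m s A).par q ∧ (cutUpper k m s A).par q ≤ m ∧
      (cutUpper k m s A).rk q = A.rk (q + k - 1) := by
    intro q h1 h2 h3
    have := hc.closed (q + k - 1) (by omega) (by omega) (by omega)
    simp only [cutUpper]
    rw [if_pos ⟨h1, h2, h3⟩, if_pos ⟨h1, h2, h3⟩]
    omega
  refine ⟨⟨?_, ?_, ?_⟩, IsHeight.isPlanar (h := fun q => h (q + k - 1)) ⟨?_, ?_, ?_, ?_, ?_⟩⟩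
  · intro q hq
    obtain ⟨h3, h1, h2⟩ := mem_erase_Icc.1 hq
    obtain ⟨e1, e2, e3, e4⟩ := hpar q h1 h2 h3
    have hTq := hT.1 (q + k - 1) (mem_erase_Icc.2 ⟨by omega, by omega, by omega⟩)
    refine ⟨Finset.mem_Icc.2 ⟨e2, e3⟩, fun e => hTq.2.1 (by omega), ?_⟩
    rw [e4]
    by_cases hb : A.par (q + k - 1) = k + s - 1
    · have hps : (cutUpper k m s A).par q = s := by omega
      rw [hps]
      have := hc.rk_lt_card_filter hT (i := q + k - 1) (by
        simp only [Finset.mem_filter, mem_children]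
        omega)
      rwa [← hc.qcount_eq] at this
    · refine hTq.2.2.trans_le (Finset.card_le_card_of_injOn (fun i => i + 1 - k) ?_ ?_)
      · intro i hi
        have hi' := mem_children.1 hi
        have : k ≤ i ∧ i < k + m ∧ i ≠ k + s - 1 := by
          by_contra hcon
          have := hc.par_out hh hi'.1.2.1 hi'.1.2.2 hi'.1.1 (by omega)
          omega
        have e5 := hpar (i + 1 - k) (by omega) (by omega) (by omega)
        rw [show i + 1 - k + k - 1 = i by omega] at e5
        rw [Finset.mem_coe, Finset.mem_filter, mem_erase_Icc]
        dsimp only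
        omega
      · intro i hi i' hi' e
        have hi := mem_children.1 hi
        have hi' := mem_children.1 hi'
        have h5 : k ≤ i := by
          by_contra hcon
          have := hc.par_out hh hi.1.2.1 hi.1.2.2 hi.1.1 (by omega)
          omega
        have h6 : k ≤ i' := by
          by_contra hcon
          have := hc.par_out hh hi'.1.2.1 hi'.1.2.2 hi'.1.1 (by omega)
          omega
        simp only at e
        omega
  · intro q hq q' hq' ep er
    obtain ⟨h3, h1, h2⟩ := mem_erase_Icc.1 hq
    obtain ⟨h3', h1', h2'⟩ := mem_erase_Icc.1 hq'
    have e := hpar q h1 h2 h3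
    have e' := hpar q' h1' h2' h3'
    have := hT.2.1 (q + k - 1) (mem_erase_Icc.2 ⟨by omega, by omega, by omega⟩)
      (q' + k - 1) (mem_erase_Icc.2 ⟨by omega, by omega, by omega⟩) (by omega) (by omega)
    omega
  · intro q hq
    rw [mem_erase_Icc] at hq
    simp only [cutUpper]
    rw [if_neg (by omega), if_neg (by omega)]
    exact ⟨rfl, rfl⟩
  · intro q q' h1 h2 h3 h1' h2' h3' e
    have := hh.inj (q + k - 1) (q' + k - 1) (by omega) (by omega) (by omega) (by omega) (by omega)
      (by omega) e
    omega
  · intro q q' h1 h2 h3 h1' h2' h3' e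
    have e1 := hpar q h1 h2 h3
    have e1' := hpar q' h1' h2' h3'
    rw [e1.2.2.2, e1'.2.2.2]
    exact hh.rk_iff (q + k - 1) (q' + k - 1) (by omega) (by omega) (by omega) (by omega) (by omega)
      (by omega) (by omega)
  · intro q h1 h2 h3
    simp only [(hpar q h1 h2 h3).1]
    exact hh.lt_par _ (by omega) (by omega) (by omega)
  · intro q h1 h2 h3
    rw [show s + k - 1 = k + s - 1 by omega]
    exact hc.lt_root hh (by omega) (by omega) (by omega)
  · intro q h1 h2 h3 l h4 h5 h6 h7
    have := hpar q h1 h2 h3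
    exact hh.lt_of_between (q + k - 1) (by omega) (by omega) (by omega) (l + k - 1) (by omega)
      (by omega) (by omega) (by omega)

lemma cutLower_par (hc : IsCut n t k m s A) {h : ℕ → ℚ} (hh : IsHeight n t A h) {p : ℕ}
    (h1 : 1 ≤ p) (h2 : p ≤ n + 1 - m) (h3 : p ≠ invP k m s t) :
    embP k m s ((cutLower n t k m s A).par p) = A.par (embP k m s p) := by
  have h3' : embP k m s p ≠ t := fun e => h3 (by rw [← e, hc.invP_embP])
  have hm := hc.embP_mem h1 h2
  simp only [cutLower]
  rw [if_pos ⟨h1, h2, h3'⟩, hc.embP_invP (hc.par_out hh hm.1 hm.2 h3' (hc.embP_out p))]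

lemma cutLower_rk (hc : IsCut n t k m s A) {p : ℕ}
    (h1 : 1 ≤ p) (h2 : p ≤ n + 1 - m) (h3 : p ≠ invP k m s t) :
    (cutLower n t k m s A).rk p = A.rk (embP k m s p) -
      (if A.par (embP k m s p) = k + s - 1 then qcount m s (cutUpper k m s A) else 0) := by
  have h3' : embP k m s p ≠ t := fun e => h3 (by rw [← e, hc.invP_embP])
  simp only [cutLower]
  rw [if_pos ⟨h1, h2, h3'⟩]

lemma cutLower_rk_lt_iff (hc : IsCut n t k m s A) (hT : A.IsTreeDiagram (Finset.Icc 1 n) t)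
    {h : ℕ → ℚ} (hh : IsHeight n t A h) {p p' : ℕ}
    (h1 : 1 ≤ p) (h2 : p ≤ n + 1 - m) (h3 : p ≠ invP k m s t)
    (h1' : 1 ≤ p') (h2' : p' ≤ n + 1 - m) (h3' : p' ≠ invP k m s t)
    (he : (cutLower n t k m s A).par p = (cutLower n t k m s A).par p') :
    ((cutLower n t k m s A).rk p < (cutLower n t k m s A).rk p' ↔
      A.rk (embP k m s p) < A.rk (embP k m s p')) := by
  have e3 : embP k m s p ≠ t := fun e => h3 (by rw [← e, hc.invP_embP])
  have e3' : embP k m s p' ≠ t := fun e => h3' (by rw [← e, hc.invP_embP])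
  have e4 := hc.cutLower_par hh h1 h2 h3
  have e4' := hc.cutLower_par hh h1' h2' h3'
  rw [he] at e4
  have e5 := e4.symm.trans e4'
  rw [hc.cutLower_rk h1 h2 h3, hc.cutLower_rk h1' h2' h3', e5]
  split_ifs with hb
  · have hm := hc.embP_mem h1 h2
    have hm' := hc.embP_mem h1' h2'
    have := hc.card_filter_le hT (mem_children.2 ⟨⟨e3, hm⟩, e5.trans hb⟩) (hc.embP_out p)
    have := hc.card_filter_le hT (mem_children.2 ⟨⟨e3', hm'⟩, hb⟩) (hc.embP_out p')
    rw [hc.qcount_eq]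
    omega
  · simp

lemma cutLower_mem (hc : IsCut n t k m s A) (hT : A.IsTreeDiagram (Finset.Icc 1 n) t)
    {h : ℕ → ℚ} (hh : IsHeight n t A h) :
    (cutLower n t k m s A).IsTreeDiagram (Finset.Icc 1 (n + 1 - m)) (invP k m s t) ∧
      IsHeight (n + 1 - m) (invP k m s t) (cutLower n t k m s A) fun p => h (embP k m s p) := by
  have het := hc.embP_invP hc.trunk_out
  have hpar := fun p h1 h2 h3 => hc.cutLower_par (p := p) hh h1 h2 h3
  have hne : ∀ {p}, p ≠ invP k m s t → embP k m s p ≠ t :=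
    fun h3 e => h3 (by rw [← e, hc.invP_embP])
  have hparmem : ∀ p, 1 ≤ p → p ≤ n + 1 - m → p ≠ invP k m s t →
      1 ≤ (cutLower n t k m s A).par p ∧ (cutLower n t k m s A).par p ≤ n + 1 - m := by
    intro p h1 h2 h3
    have hm := hc.embP_mem h1 h2
    have hTp := hT.1 (embP k m s p) (mem_erase_Icc.2 ⟨hne h3, hm⟩)
    have hr := Finset.mem_Icc.1 hTp.1
    have := hc.invP_mem hr.1 hr.2 (hc.par_out hh hm.1 hm.2 (hne h3) (hc.embP_out p))
    rwa [← hpar p h1 h2 h3, hc.invP_embP] at this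
  refine ⟨⟨?_, ?_, ?_⟩, ⟨?_, ?_, ?_, ?_, ?_⟩⟩
  · intro p hp
    obtain ⟨h3, h1, h2⟩ := mem_erase_Icc.1 hp
    have hm := hc.embP_mem h1 h2
    have hTp := hT.1 (embP k m s p) (mem_erase_Icc.2 ⟨hne h3, hm⟩)
    refine ⟨Finset.mem_Icc.2 (hparmem p h1 h2 h3), fun e => hTp.2.1 ?_, ?_⟩
    · rw [← hpar p h1 h2 h3, e]
    · have hcard : ((children n t A (A.par (embP k m s p))).filter
          fun i => ¬ (k ≤ i ∧ i < k + m ∧ i ≠ k + s - 1)).card ≤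
          (((Finset.Icc 1 (n + 1 - m)).erase (invP k m s t)).filter fun b =>
            (cutLower n t k m s A).par b = (cutLower n t k m s A).par p).card := by
        have hmem : ∀ i ∈ (children n t A (A.par (embP k m s p))).filter
            (fun i => ¬ (k ≤ i ∧ i < k + m ∧ i ≠ k + s - 1)),
            (i ≠ t ∧ 1 ≤ i ∧ i ≤ n) ∧ A.par i = A.par (embP k m s p) ∧
              (i < k ∨ k + m ≤ i ∨ i = k + s - 1) := by
          intro i hi
          simp only [Finset.mem_filter, mem_children] at hi
          exact ⟨hi.1.1, hi.1.2, by omega⟩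
        refine Finset.card_le_card_of_injOn (fun i => invP k m s i) ?_ ?_
        · intro i hi
          obtain ⟨hi1, hi2, hi3⟩ := hmem i hi
          have hinv := hc.invP_mem hi1.2.1 hi1.2.2 hi3
          have hit : invP k m s i ≠ invP k m s t := by
            intro e
            apply hi1.1
            rw [← hc.embP_invP hi3, e, het]
          rw [Finset.mem_coe, Finset.mem_filter, mem_erase_Icc]
          refine ⟨⟨hit, hinv⟩, hc.embP_inj ?_⟩
          rw [hpar _ hinv.1 hinv.2 hit, hpar p h1 h2 h3, hc.embP_invP hi3, hi2]
        · intro i hi i' hi' e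
          simp only at e
          rw [← hc.embP_invP (hmem i hi).2.2, e, hc.embP_invP (hmem i' hi').2.2]
      refine lt_of_lt_of_le ?_ hcard
      have hsum := Finset.card_filter_add_card_filter_not
        (s := children n t A (A.par (embP k m s p)))
        (fun i => k ≤ i ∧ i < k + m ∧ i ≠ k + s - 1)
      have hrk : A.rk (embP k m s p) < (children n t A (A.par (embP k m s p))).card := hTp.2.2
      rw [hc.cutLower_rk h1 h2 h3]
      split_ifs with hb
      · have := hc.card_filter_le hT (mem_children.2 ⟨⟨hne h3, hm⟩, hb⟩) (hc.embP_out p)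
        rw [hc.qcount_eq]
        rw [hb] at hsum hrk ⊢
        omega
      · have : (children n t A (A.par (embP k m s p))).filter
            (fun i => k ≤ i ∧ i < k + m ∧ i ≠ k + s - 1) = ∅ := by
          refine Finset.filter_eq_empty_iff.2 fun i hi hcon => ?_
          have := hc.closed i hcon.1 hcon.2.1 hcon.2.2
          have := hc.par_out hh hm.1 hm.2 (hne h3) (hc.embP_out p)
          have := (mem_children.1 hi).2
          omega
        rw [this, Finset.card_empty] at hsum
        omega
  · intro p hp p' hp' ep er
    obtain ⟨h3, h1, h2⟩ := mem_erase_Icc.1 hp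
    obtain ⟨h3', h1', h2'⟩ := mem_erase_Icc.1 hp'
    have l1 := hc.cutLower_rk_lt_iff hT hh h1 h2 h3 h1' h2' h3' ep
    have l2 := hc.cutLower_rk_lt_iff hT hh h1' h2' h3' h1 h2 h3 ep.symm
    apply hc.embP_inj
    refine hT.2.1 _ (mem_erase_Icc.2 ⟨hne h3, hc.embP_mem h1 h2⟩)
      _ (mem_erase_Icc.2 ⟨hne h3', hc.embP_mem h1' h2'⟩) ?_ (by omega)
    rw [← hpar p h1 h2 h3, ep, hpar p' h1' h2' h3']
  · intro p hp
    have : ¬ (1 ≤ p ∧ p ≤ n + 1 - m ∧ embP k m s p ≠ t) := by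
      rintro ⟨h1, h2, h3⟩
      refine hp (mem_erase_Icc.2 ⟨fun e => h3 ?_, h1, h2⟩)
      rw [e, het]
    simp only [cutLower]
    rw [if_neg this, if_neg this]
    exact ⟨rfl, rfl⟩
  · intro p p' h1 h2 h3 h1' h2' h3' e
    have hm := hc.embP_mem h1 h2
    have hm' := hc.embP_mem h1' h2'
    exact hc.embP_inj (hh.inj _ _ hm.1 hm.2 (hne h3) hm'.1 hm'.2 (hne h3') e)
  · intro p p' h1 h2 h3 h1' h2' h3' e
    have hm := hc.embP_mem h1 h2
    have hm' := hc.embP_mem h1' h2'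
    rw [hc.cutLower_rk_lt_iff hT hh h1 h2 h3 h1' h2' h3' e]
    refine hh.rk_iff _ _ hm.1 hm.2 (hne h3) hm'.1 hm'.2 (hne h3') ?_
    rw [← hpar p h1 h2 h3, e, hpar p' h1' h2' h3']
  · intro p h1 h2 h3
    have hm := hc.embP_mem h1 h2
    simp only [hpar p h1 h2 h3]
    exact hh.lt_par _ hm.1 hm.2 (hne h3)
  · intro p h1 h2 h3
    have hm := hc.embP_mem h1 h2
    simp only [het]
    exact hh.lt_trunk _ hm.1 hm.2 (hne h3)
  · intro p h1 h2 h3 l h4 h5 h6 h7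
    have hm := hc.embP_mem h1 h2
    have hl := hc.embP_mem h4 h5
    refine hh.lt_of_between _ hm.1 hm.2 (hne h3) _ hl.1 hl.2 ?_ ?_
    · rw [← hpar p h1 h2 h3]
      rcases min_lt_iff.1 h6 with h | h
      · exact min_lt_of_left_lt (hc.embP_lt h)
      · exact min_lt_of_right_lt (hc.embP_lt h)
    · rw [← hpar p h1 h2 h3]
      rcases lt_max_iff.1 h7 with h | h
      · exact lt_max_of_lt_left (hc.embP_lt h)
      · exact lt_max_of_lt_right (hc.embP_lt h)

end IsCut

lemma eq_etree {E : PreTree} (hE : E.IsTreeDiagram (Finset.Icc 1 2) 1) : E = etree := by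
  have h2 := hE.1 2 (by decide)
  have hcard := h2.2.2.trans_le (Finset.card_filter_le _ _)
  have hp := Finset.mem_Icc.1 h2.1
  rw [show ((Finset.Icc 1 2).erase 1).card = 1 from rfl] at hcard
  have key : ∀ i, E.par i = etree.par i ∧ E.rk i = etree.rk i := by
    intro i
    by_cases hi : i = 2
    · subst hi
      simp only [etree, if_true]
      omega
    · have := hE.2.2 i (by rw [mem_erase_Icc]; omega)
      simpa only [etree, if_neg hi] using this
  cases E
  simp only [etree, PreTree.mk.injEq] at key ⊢
  exact ⟨funext fun i => (key i).1, funext fun i => (key i).2⟩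

lemma eq_ebar {E : PreTree} (hE : E.IsTreeDiagram (Finset.Icc 1 2) 2) : E = ebar := by
  have h1 := hE.1 1 (by decide)
  have hcard := h1.2.2.trans_le (Finset.card_filter_le _ _)
  have hp := Finset.mem_Icc.1 h1.1
  rw [show ((Finset.Icc 1 2).erase 2).card = 1 from rfl] at hcard
  have key : ∀ i, E.par i = ebar.par i ∧ E.rk i = ebar.rk i := by
    intro i
    by_cases hi : i = 1
    · subst hi
      simp only [ebar, if_true]
      omega
    · have := hE.2.2 i (by rw [mem_erase_Icc]; omega)
      simpa only [ebar, if_neg hi] using this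
  cases E
  simp only [ebar, PreTree.mk.injEq] at key ⊢
  exact ⟨funext fun i => (key i).1, funext fun i => (key i).2⟩

/-- The strings from which one reaches a string satisfying `C` by following the arrows. -/
lemma exists_descendants {n t : ℕ} {A : PreTree} (hT : A.IsTreeDiagram (Finset.Icc 1 n) t)
    (C : ℕ → Prop) : ∃ D : Finset ℕ, (∀ i ∈ D, 1 ≤ i ∧ i ≤ n) ∧
      (∀ i, 1 ≤ i → i ≤ n → C i → i ∈ D) ∧
      (∀ i, 1 ≤ i → i ≤ n → ¬ C i → (i ∈ D ↔ A.par i ∈ D)) ∧ (¬ C t → t ∉ D) := by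
  classical
  have hpt : A.par t = t := (hT.2.2 t (by simp)).1
  refine ⟨(Finset.Icc 1 n).filter fun i => ∃ m, C (A.par^[m] i), ?_, ?_, ?_, ?_⟩
  · intro i hi
    exact Finset.mem_Icc.1 (Finset.mem_filter.1 hi).1
  · intro i h1 h2 h3
    exact Finset.mem_filter.2 ⟨Finset.mem_Icc.2 ⟨h1, h2⟩, 0, h3⟩
  · intro i h1 h2 h3
    have hp : A.par i ∈ Finset.Icc 1 n := by
      by_cases hi : i = t
      · rw [hi, hpt, ← hi, Finset.mem_Icc]
        exact ⟨h1, h2⟩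
      · exact (hT.1 i (mem_erase_Icc.2 ⟨hi, h1, h2⟩)).1
    rw [Finset.mem_filter, Finset.mem_filter]
    constructor
    · rintro ⟨-, m, hm⟩
      cases m with
      | zero => exact absurd hm h3
      | succ m => exact ⟨hp, m, hm⟩
    · rintro ⟨-, m, hm⟩
      exact ⟨Finset.mem_Icc.2 ⟨h1, h2⟩, m + 1, hm⟩
  · intro h3 h4
    obtain ⟨m, hm⟩ := (Finset.mem_filter.1 h4).2
    rw [Function.iterate_fixed hpt] at hm
    exact h3 hm

lemma exists_threshold {N : ℕ} {L R : Finset ℕ}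
    (hL : ∀ x ∈ L, ∀ z ∈ L, ∀ y, x < y → y < z → y ∈ L)
    (hR : ∀ x ∈ R, ∀ z ∈ R, ∀ y, x < y → y < z → y ∈ R)
    (hLR : ∀ i, 1 ≤ i → i ≤ N → (i ∈ R ↔ i ∉ L)) {x y : ℕ} (hx : x ∈ L) (hy : y ∈ R)
    (hxy : x < y) (hx1 : 1 ≤ x) (hyN : y ≤ N) :
    ∃ s, ∀ i, 1 ≤ i → i ≤ N → (i ∈ L ↔ i ≤ s) := by
  refine ⟨L.max' ⟨x, hx⟩, fun i h1 h2 => ⟨fun h => L.le_max' i h, fun h => ?_⟩⟩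
  by_contra hi
  have hiR := (hLR i h1 h2).2 hi
  have hmem := L.max'_mem ⟨x, hx⟩
  rcases lt_trichotomy i x with hlt | rfl | hgt
  · exact (hLR x hx1 (by omega)).1 (hR i hiR y hy x hlt hxy) hx
  · exact hi hx
  · refine hi (hL x hx _ hmem i hgt (lt_of_le_of_ne h ?_))
    rintro rfl
    exact hi hmem

lemma exists_eq_stack_stack {N τ a s ρ₁ ρ₂ : ℕ} {Q : PreTree}
    (hT : Q.IsTreeDiagram (Finset.Icc 1 N) τ) {h : ℕ → ℚ} (hh : IsHeight N τ Q h)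
    (h1 : 1 ≤ ρ₁) (h2 : ρ₁ ≤ s) (h3 : s < ρ₂) (h4 : ρ₂ ≤ N)
    (hroots : ρ₁ = τ ∧ ρ₂ = a ∨ ρ₁ = a ∧ ρ₂ = τ) (hpa : Q.par a = τ)
    (hleft : ∀ i, 1 ≤ i → i ≤ s → i ≠ ρ₁ → Q.par i ≤ s)
    (hright : ∀ i, s < i → i ≤ N → i ≠ ρ₂ → s < Q.par i)
    (hrk : ∀ i, 1 ≤ i → i ≤ N → i ≠ τ → i ≠ a → Q.par i = τ → Q.rk i < Q.rk a) :
    ∃ E R S : PreTree, R ∈ TreeSetFull (N - s) (ρ₂ - s) ∧ S ∈ TreeSetFull s ρ₁ ∧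
      E.IsTreeDiagram (Finset.Icc 1 2) (if ρ₁ = τ then 1 else 2) ∧
      Q = stack 1 s ρ₁ (stack 2 (N - s) (ρ₂ - s) E R) S := by
  have hmem : ∀ i, 1 ≤ i → i ≤ N → i ≠ τ → 1 ≤ Q.par i ∧ Q.par i ≤ N := fun i hi hi' hit =>
    Finset.mem_Icc.1 (hT.1 i (mem_erase_Icc.2 ⟨hit, hi, hi'⟩)).1
  have hc : IsCut N τ 1 s ρ₁ Q := by
    refine ⟨le_rfl, h1, h2, by omega, by omega, ?_, ?_, ?_⟩
    · intro i hi hi' hir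
      have := hleft i hi (by omega) (by omega)
      have := hmem i hi (by omega) (by omega)
      omega
    · intro i hi hi' hit hout
      by_cases hi2 : i = ρ₂
      · have : i = a := by omega
        rw [this, hpa]
        omega
      · have := hright i (by omega) hi' hi2
        omega
    · intro i i' hi hi' hir hpi hi1 hi1' hit hout hpi'
      have hi2 : i' = ρ₂ := by
        by_contra hcon
        have := hright i' (by omega) hi1' hcon
        omega
      have : i' = a := by omega
      rw [this]
      exact hrk i hi (by omega) (by omega) (by omega) (by omega)
  obtain ⟨hTB, hhB⟩ := hc.cutLower_mem hT hh
  have hQ := hc.eq_stack hT hh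
  set B := cutLower N τ 1 s ρ₁ Q with hB
  set τ' := invP 1 s ρ₁ τ with hτ'
  have hτ1 : ρ₁ = τ → τ' = 1 := by
    intro e
    rw [hτ', ← e]
    unfold invP
    split_ifs <;> omega
  have hτ2 : ρ₂ = τ → τ' = τ - s + 1 := by
    intro e
    rw [hτ', ← e]
    unfold invP
    split_ifs <;> omega
  have hemb : ∀ p, 2 ≤ p → embP 1 s ρ₁ p = p + s - 1 := by
    intro p hp
    unfold embP
    split_ifs <;> omega
  have hemb1 : embP 1 s ρ₁ 1 = ρ₁ := by
    unfold embP
    split_ifs <;> omega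
  have hembgt : ∀ p, s < embP 1 s ρ₁ p → 2 ≤ p := by
    intro p hp
    unfold embP at hp
    split_ifs at hp <;> omega
  have hparB : ∀ p, 1 ≤ p → p ≤ N + 1 - s → p ≠ τ' →
      embP 1 s ρ₁ (B.par p) = Q.par (embP 1 s ρ₁ p) :=
    fun p hp hp' hpt => hc.cutLower_par hh hp hp' hpt
  have hcB : IsCut (N + 1 - s) τ' 2 (N - s) (ρ₂ - s) B := by
    refine ⟨by omega, by omega, by omega, by omega, by omega, ?_, ?_, ?_⟩
    · intro p hp hp' hpr
      have e := hparB p (by omega) (by omega) (by omega)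
      rw [hemb p hp] at e
      have hgt := hright (p + s - 1) (by omega) (by omega) (by omega)
      have hle := hmem (p + s - 1) (by omega) (by omega) (by omega)
      have h2p := hembgt _ (e ▸ hgt)
      rw [hemb _ h2p] at e
      omega
    · intro p hp hp' hpt hout
      have hp1 : p = 1 := by omega
      subst hp1
      have hρ : ρ₁ = a ∧ ρ₂ = τ := by omega
      have e := hparB 1 (by omega) (by omega) hpt
      rw [hemb1, hρ.1, hpa, ← hρ.1] at e
      have h2p := hembgt (B.par 1) (by omega)
      rw [hemb _ h2p] at e
      omega
    · intro p p' hp hp' hpr hpp hp1 hp1' hpt hout hpp'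
      have hp1 : p' = 1 := by omega
      subst hp1
      have hρ : ρ₁ = a ∧ ρ₂ = τ := by omega
      have e := hparB p (by omega) (by omega) (by omega)
      rw [hemb p hp, hpp, hemb _ (by omega)] at e
      have := hc.cutLower_rk_lt_iff hT hh (p := p) (p' := 1) (by omega) (by omega) (by omega)
        (by omega) (by omega) hpt (hpp.trans hpp'.symm)
      rw [this, hemb p hp, hemb1, hρ.1]
      exact hrk _ (by omega) (by omega) (by omega) (by omega) (by omega)
  have hE := (hcB.cutLower_mem hTB hhB).1
  have hB2 := hcB.eq_stack hTB hhB
  refine ⟨_, _, _, hcB.cutUpper_mem hTB hhB, hc.cutUpper_mem hT hh, ?_,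
    hQ.trans (congrArg (fun X => stack 1 s ρ₁ X _) hB2)⟩
  have e1 : N + 1 - s + 1 - (N - s) = 2 := by omega
  have e2 : invP 2 (N - s) (ρ₂ - s) τ' = if ρ₁ = τ then 1 else 2 := by
    unfold invP
    split_ifs <;> omega
  rwa [e1, e2] at hE

/-- Decomposition of a planar tree diagram with respect to the lowest arrow on its trunk. -/
lemma exists_decomposition_of_lowest {N τ a : ℕ} {Q : PreTree} (hτ : 1 ≤ τ ∧ τ ≤ N)
    (hT : Q.IsTreeDiagram (Finset.Icc 1 N) τ) {h : ℕ → ℚ} (hh : IsHeight N τ Q h)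
    (ha : 1 ≤ a ∧ a ≤ N) (haτ : a ≠ τ) (hpa : Q.par a = τ)
    (hmax : ∀ i, 1 ≤ i → i ≤ N → i ≠ τ → Q.par i = τ → Q.rk i ≤ Q.rk a) :
    ∃ (r s vR vS : ℕ) (R S : PreTree), R ∈ TreeSetFull r vR ∧ S ∈ TreeSetFull s vS ∧
      1 ≤ vR ∧ vR ≤ r ∧ 1 ≤ vS ∧ vS ≤ s ∧ N = r + s ∧
      (τ < a → Q = stack 1 s vS (stack 2 r vR etree R) S ∧ τ = vS ∧ a = s + vR) ∧
      (a < τ → Q = stack 1 s vS (stack 2 r vR ebar R) S ∧ a = vS ∧ τ = s + vR) := by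
  have hmem : ∀ i, 1 ≤ i → i ≤ N → i ≠ τ → 1 ≤ Q.par i ∧ Q.par i ≤ N := fun i hi hi' hit =>
    Finset.mem_Icc.1 (hT.1 i (mem_erase_Icc.2 ⟨hit, hi, hi'⟩)).1
  have hrk : ∀ i, 1 ≤ i → i ≤ N → i ≠ τ → i ≠ a → Q.par i = τ → Q.rk i < Q.rk a := by
    intro i hi hi' hit hia hpi
    refine lt_of_le_of_ne (hmax i hi hi' hit hpi) fun e => hia ?_
    exact hT.2.1 i (mem_erase_Icc.2 ⟨hit, hi, hi'⟩) a (mem_erase_Icc.2 ⟨haτ, ha⟩)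
      (hpi.trans hpa.symm) e
  have hle : ∀ i, 1 ≤ i → i ≤ N → i ≠ τ → i ≠ a → h i < h a := by
    intro i hi hi' hit hia
    have haI := mem_erase_Icc.2 ⟨haτ, ha⟩
    obtain ⟨x, hx, hxmax⟩ := ((Finset.Icc 1 N).erase τ).exists_max_image h ⟨a, haI⟩
    have hix := hxmax i (mem_erase_Icc.2 ⟨hit, hi, hi'⟩)
    have hax := hxmax a haI
    rw [mem_erase_Icc] at hx
    have hlt := hh.lt_par x hx.2.1 hx.2.2 hx.1
    have hxp := hmem x hx.2.1 hx.2.2 hx.1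
    have hpx : Q.par x = τ := by
      by_contra hcon
      exact absurd (hxmax _ (mem_erase_Icc.2 ⟨hcon, hxp⟩)) (not_le.2 hlt)
    have hxa : x = a := by
      by_contra hcon
      have := (hh.rk_iff x a hx.2.1 hx.2.2 hx.1 ha.1 ha.2 haτ (hpx.trans hpa.symm)).1
        (hrk x hx.2.1 hx.2.2 hx.1 hcon hpx)
      exact absurd hax (not_le.2 this)
    rw [hxa] at hix
    exact lt_of_le_of_ne hix fun e => hia (hh.inj i a hi hi' hit ha.1 ha.2 haτ e)
  obtain ⟨D, hD1, hD2, hD3, hD4⟩ := exists_descendants hT (· = a)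
  have haD := hD2 a ha.1 ha.2 rfl
  have hτD := hD4 haτ.symm
  let K := (Finset.Icc 1 N).filter (· ∉ D)
  have memK : ∀ i, i ∈ K ↔ (1 ≤ i ∧ i ≤ N) ∧ i ∉ D := by
    intro i
    simp only [K, Finset.mem_filter, Finset.mem_Icc]
  have hDK : ∀ i, 1 ≤ i → i ≤ N → (i ∈ K ↔ i ∉ D) := by
    intro i hi hi'
    simp [memK, hi, hi']
  have hKD : ∀ i, 1 ≤ i → i ≤ N → (i ∈ D ↔ i ∉ K) := by
    intro i hi hi'
    rw [hDK i hi hi', not_not]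
  have hτK : τ ∈ K := (memK τ).2 ⟨hτ, hτD⟩
  have hKcl : ∀ i ∈ K, i ≠ τ → Q.par i ∈ K := by
    intro i hi hit
    rw [memK] at hi
    refine (memK _).2 ⟨hmem i hi.1.1 hi.1.2 hit, fun hp => hi.2 ?_⟩
    refine (hD3 i hi.1.1 hi.1.2 ?_).2 hp
    rintro rfl
    exact hi.2 haD
  have hDcl : ∀ i ∈ D, i ≠ a → Q.par i ∈ D := fun i hi hia =>
    (hD3 i (hD1 i hi).1 (hD1 i hi).2 hia).1 hi
  have hDconv := hh.mem_of_between hT hD1 (fun hcon => absurd hcon hτD) haD hDcl (by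
    intro y hy hy' _ hyD
    refine Or.inl fun hp => hyD ?_
    refine (hD3 y hy hy' ?_).2 hp
    rintro rfl
    exact hyD haD)
  have hKconv := hh.mem_of_between hT (fun i hi => ((memK i).1 hi).1) (fun _ => rfl) hτK hKcl (by
    intro y hy hy' _ hyK
    have hyD := (hKD y hy hy').2 hyK
    by_cases hya : y = a
    · subst hya
      refine Or.inr ⟨hpa, fun i hi hit => ?_⟩
      rw [memK] at hi
      refine hle i hi.1.1 hi.1.2 hit ?_
      rintro rfl
      exact hi.2 hyD
    · exact Or.inl fun hp => ((memK _).1 hp).2 (hDcl y hyD hya))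
  rcases lt_or_gt_of_ne haτ with hlt | hlt
  · obtain ⟨s, hs⟩ := exists_threshold hDconv hKconv hDK haD hτK hlt ha.1 hτ.2
    have h2 := (hs a ha.1 ha.2).1 haD
    have h3 : s < τ := by
      by_contra! hcon
      exact hτD ((hs τ hτ.1 hτ.2).2 hcon)
    obtain ⟨E, R, S, hR, hS, hE, hQ⟩ := exists_eq_stack_stack (s := s) hT hh ha.1 h2 h3 hτ.2
      (Or.inr ⟨rfl, rfl⟩) hpa
      (fun i hi hi' hir => by
        have hp := hDcl i ((hs i hi (by omega)).2 hi') hir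
        exact (hs _ (hD1 _ hp).1 (hD1 _ hp).2).1 hp)
      (fun i hi hi' hir => by
        have hiK : i ∈ K := (memK i).2 ⟨⟨by omega, hi'⟩, fun hcon => by
          have := (hs i (by omega) hi').1 hcon
          omega⟩
        have hp := (memK _).1 (hKcl i hiK hir)
        by_contra! hcon
        exact hp.2 ((hs _ hp.1.1 hp.1.2).2 hcon))
      hrk
    rw [if_neg haτ] at hE
    rw [eq_ebar hE] at hQ
    exact ⟨N - s, s, τ - s, a, R, S, hR, hS, by omega, by omega, by omega, by omega, by omega,
      fun hcon => by omega, fun _ => ⟨hQ, rfl, by omega⟩⟩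
  · obtain ⟨s, hs⟩ := exists_threshold hKconv hDconv hKD hτK haD hlt hτ.1 ha.2
    have h2 := (hs τ hτ.1 hτ.2).1 hτK
    have h3 : s < a := by
      by_contra! hcon
      exact ((memK a).1 ((hs a ha.1 ha.2).2 hcon)).2 haD
    obtain ⟨E, R, S, hR, hS, hE, hQ⟩ := exists_eq_stack_stack (s := s) hT hh hτ.1 h2 h3 ha.2
      (Or.inl ⟨rfl, rfl⟩) hpa
      (fun i hi hi' hir => by
        have hp := hKcl i ((hs i hi (by omega)).2 hi') hir
        have hpr := ((memK _).1 hp).1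
        exact (hs _ hpr.1 hpr.2).1 hp)
      (fun i hi hi' hir => by
        have hiD : i ∈ D := (hKD i (by omega) hi').2 fun hcon => by
          have := (hs i (by omega) hi').1 hcon
          omega
        have hp := hDcl i hiD hir
        have hpr := hD1 _ hp
        by_contra! hcon
        exact ((memK _).1 ((hs _ hpr.1 hpr.2).2 hcon)).2 hp)
      hrk
    rw [if_pos rfl] at hE
    rw [eq_etree hE] at hQ
    exact ⟨N - s, s, a - s, τ, R, S, hR, hS, by omega, by omega, by omega, by omega, by omega,
      fun _ => ⟨hQ, rfl, by omega⟩, fun hcon => by omega⟩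

/-- The part of a planar tree diagram lying above the head of the arrow tailed at `a`, that arrow
included, can be cut off. -/
lemma exists_isCut {n t a : ℕ} {A : PreTree} (hT : A.IsTreeDiagram (Finset.Icc 1 n) t)
    {h : ℕ → ℚ} (hh : IsHeight n t A h) (ha : a ∈ (Finset.Icc 1 n).erase t) :
    ∃ k m s, IsCut n t k m s A ∧ A.par a = k + s - 1 ∧ k ≤ a ∧ a < k + m ∧
      ∀ i, k ≤ i → i < k + m → i ≠ A.par a → A.par i = A.par a → A.rk i ≤ A.rk a := by
  have hTa := hT.1 a ha
  have hbr := Finset.mem_Icc.1 hTa.1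
  have ha' := mem_erase_Icc.1 ha
  set b := A.par a with hb
  let C : ℕ → Prop := fun i => (1 ≤ i ∧ i ≤ n) ∧ i ≠ t ∧ A.par i = b ∧ A.rk i ≤ A.rk a
  obtain ⟨D, hD1, hD2, hD3, hD4⟩ := exists_descendants hT C
  have htD : t ∉ D := hD4 fun hC => hC.2.1 rfl
  have haD : a ∈ D := hD2 a ha'.2.1 ha'.2.2 ⟨ha'.2, ha'.1, rfl, le_rfl⟩
  obtain ⟨x, hxD, hxmax⟩ := D.exists_max_image h ⟨a, haD⟩
  have hxr := hD1 x hxD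
  have hxt : x ≠ t := by rintro rfl; exact htD hxD
  have hxlt := hh.lt_par x hxr.1 hxr.2 hxt
  have hxC : C x := by
    by_contra hcon
    exact absurd (hxmax _ ((hD3 x hxr.1 hxr.2 hcon).1 hxD)) (not_le.2 hxlt)
  have hbD : b ∉ D := fun hcon => by
    rw [hxC.2.2.1] at hxlt
    exact absurd (hxmax b hcon) (not_le.2 hxlt)
  have hDC : ∀ i ∈ D, A.par i = b → C i := by
    intro i hi hp
    by_contra hcon
    exact hbD (hp ▸ (hD3 i (hD1 i hi).1 (hD1 i hi).2 hcon).1 hi)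
  have hDle : ∀ i ∈ D, h i ≤ h a := by
    intro i hi
    refine (hxmax i hi).trans (not_lt.1 fun hcon => ?_)
    have := (hh.rk_iff a x ha'.2.1 ha'.2.2 ha'.1 hxr.1 hxr.2 hxt hxC.2.2.1.symm).2 hcon
    have := hxC.2.2.2
    omega
  let J := insert b D
  have memJ : ∀ i, i ∈ J ↔ i = b ∨ i ∈ D := fun i => Finset.mem_insert
  have hJr : ∀ i ∈ J, 1 ≤ i ∧ i ≤ n := by
    intro i hi
    rcases (memJ i).1 hi with rfl | hi
    · exact hbr
    · exact hD1 i hi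
  have hbJ : b ∈ J := (memJ b).2 (Or.inl rfl)
  have htJ : t ∈ J → t = b := fun hi => ((memJ t).1 hi).resolve_right htD
  have hcl : ∀ i ∈ J, i ≠ b → A.par i ∈ J := by
    intro i hi hib
    have hiD := ((memJ i).1 hi).resolve_left hib
    rw [memJ]
    by_cases hC : C i
    · exact Or.inl hC.2.2.1
    · exact Or.inr ((hD3 i (hD1 i hiD).1 (hD1 i hiD).2 hC).1 hiD)
  have hout : ∀ y, 1 ≤ y → y ≤ n → y ∉ J → A.par y ∉ J ∨ A.par y = b := by
    intro y hy hy' hyJ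
    by_contra! hcon
    have hyD : y ∉ D := fun e => hyJ ((memJ y).2 (Or.inr e))
    have hpD := ((memJ _).1 hcon.1).resolve_left hcon.2
    exact hyD ((hD3 y hy hy' fun hC => hcon.2 hC.2.2.1).2 hpD)
  have hrk : ∀ y, 1 ≤ y → y ≤ n → y ≠ t → y ∉ J → A.par y = b → A.rk a < A.rk y := by
    intro y hy hy' hyt hyJ hp
    by_contra! hcon
    exact hyJ ((memJ y).2 (Or.inr (hD2 y hy hy' ⟨⟨hy, hy'⟩, hyt, hp, hcon⟩)))
  have hconv := hh.mem_of_between hT hJr htJ hbJ hcl (by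
    intro y hy hy' hyt hyJ
    by_cases hp : A.par y = b
    · refine Or.inr ⟨hp, fun i hi hib => ?_⟩
      refine (hDle i (((memJ i).1 hi).resolve_left hib)).trans_lt ?_
      exact (hh.rk_iff a y ha'.2.1 ha'.2.2 ha'.1 hy hy' hyt hp.symm).1 (hrk y hy hy' hyt hyJ hp)
    · exact Or.inl ((hout y hy hy' hyJ).resolve_right hp))
  have hne : J.Nonempty := ⟨b, hbJ⟩
  obtain ⟨k, hk⟩ : ∃ k, k = J.min' hne := ⟨_, rfl⟩
  obtain ⟨l, hl⟩ : ∃ l, l = J.max' hne := ⟨_, rfl⟩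
  have hkJ : k ∈ J := hk ▸ J.min'_mem hne
  have hlJ : l ∈ J := hl ▸ J.max'_mem hne
  have hJ : ∀ i, i ∈ J ↔ k ≤ i ∧ i ≤ l := by
    refine fun i => ⟨fun hi => ⟨hk ▸ J.min'_le i hi, hl ▸ J.le_max' i hi⟩, fun hi => ?_⟩
    rcases hi.1.eq_or_lt with rfl | h1
    · exact hkJ
    rcases hi.2.eq_or_lt with rfl | h2
    · exact hlJ
    exact hconv k hkJ l hlJ i h1 h2
  have hkr := hJr k hkJ
  have hlr := hJr l hlJ
  have hbk := (hJ b).1 hbJ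
  have hak := (hJ a).1 ((memJ a).2 (Or.inr haD))
  have hDof : ∀ i, k ≤ i → i < k + (l + 1 - k) → i ≠ b → i ∈ D := fun i hi hi' hib =>
    ((memJ i).1 ((hJ i).2 ⟨hi, by omega⟩)).resolve_left hib
  have hJof : ∀ i, i < k ∨ k + (l + 1 - k) ≤ i → i ∉ J := fun i hi hcon => by
    have := (hJ i).1 hcon
    omega
  refine ⟨k, l + 1 - k, b + 1 - k, ⟨hkr.1, by omega, by omega, by omega, ?_, ?_, ?_, ?_⟩,
    by omega, hak.1, by omega, ?_⟩
  · intro h1 h2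
    have := htJ ((hJ t).2 ⟨h1, by omega⟩)
    omega
  · intro i h1 h2 h3
    have := (hJ _).1 (hcl i ((hJ i).2 ⟨h1, by omega⟩) (by omega))
    omega
  · intro i h1 h2 _ h4
    rcases hout i h1 h2 (hJof i h4) with hp | hp
    · rw [hJ] at hp
      omega
    · omega
  · intro i i' h1 h2 h3 h4 h5 h6 h7 h8 h9
    have hC := hDC i (hDof i h1 h2 (by omega)) (by omega)
    exact hC.2.2.2.trans_lt (hrk i' h5 h6 h7 (hJof i' h8) (by omega))
  · intro i h1 h2 h3 h4
    exact (hDC i (hDof i h1 h2 h3) h4).2.2.2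

/-- **Decomposition of a planar tree diagram with respect to an arrow.**
For any `A ∈ 𝒜(n;t)` and any arrow `α` of `A` (tailed at the string `a`, with
head on the string `A.par a`), there are planar tree diagrams `P, R, S` (each
possibly trivial) with `p`, `r`, `s` leaves respectively, `n = p + r + s - 1`,
such that `A = P ≺ᵥ Q`, where `v` is the index in `P` of the leaf
corresponding to the head string of `α` in `A`, and
`Q = (e ≺₂ R) ≺₁ S` if the head of `α` lies left of its tail, while
`Q = (ē ≺₂ R) ≺₁ S` if the head lies right of the tail, the elementary tree
`e` (resp. `ē`) corresponding to the arrow `α` of `A`. -/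
theorem tree_arrow_decomposition (n t : ℕ) (ht : 1 ≤ t ∧ t ≤ n)
    (A : PreTree) (hA : A ∈ TreeSetFull n t)
    (a : ℕ) (ha : a ∈ (Finset.Icc 1 n).erase t) :
    ∃ (p r s vP vR vS : ℕ) (P R S : PreTree),
      P ∈ TreeSetFull p vP ∧ R ∈ TreeSetFull r vR ∧ S ∈ TreeSetFull s vS ∧
      1 ≤ vP ∧ vP ≤ p ∧ 1 ≤ vR ∧ vR ≤ r ∧ 1 ≤ vS ∧ vS ≤ s ∧
      n = p + r + s - 1 ∧
      ∃ v, 1 ≤ v ∧ v ≤ p ∧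
        (A.par a < a →
          A = stack v (r + s) vS P (stack 1 s vS (stack 2 r vR etree R) S) ∧
          A.par a = v + vS - 1 ∧ a = v + s + vR - 1) ∧
        (a < A.par a →
          A = stack v (r + s) (vR + s) P (stack 1 s vS (stack 2 r vR ebar R) S) ∧
          a = v + vS - 1 ∧ A.par a = v + vR + s - 1) := by
  obtain ⟨hT, hP⟩ := hA
  obtain ⟨h, hh⟩ := hP.exists_isHeight hT
  obtain ⟨k, m, σ, hc, hb, hak, ham, hrk⟩ := exists_isCut hT hh ha
  have hk := hc.one_le_k; have hs1 := hc.one_le_s; have hsm := hc.s_le; have hn := hc.le_n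
  have hne := (hT.1 a ha).2.1
  obtain ⟨hTP, hhP⟩ := hc.cutLower_mem hT hh
  have hQ := hc.cutUpper_mem hT hh
  have hA := hc.eq_stack hT hh
  obtain ⟨g, hg⟩ := hQ.2.exists_isHeight hQ.1
  have hpar : ∀ q, 1 ≤ q → q ≤ m → q ≠ σ →
      (cutUpper k m σ A).par q = A.par (q + k - 1) + 1 - k ∧
        (cutUpper k m σ A).rk q = A.rk (q + k - 1) := by
    intro q h1 h2 h3
    simp only [cutUpper]
    rw [if_pos ⟨h1, h2, h3⟩, if_pos ⟨h1, h2, h3⟩]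
    exact ⟨rfl, rfl⟩
  have ha1 := hpar (a + 1 - k) (by omega) (by omega) (by omega)
  rw [show a + 1 - k + k - 1 = a by omega] at ha1
  obtain ⟨r, s, vR, vS, R, S, hR, hS, h1, h2, h3, h4, hm, hlt, hgt⟩ :=
    exists_decomposition_of_lowest (a := a + 1 - k) ⟨hs1, hsm⟩ hQ.1 hg (by omega) (by omega)
      (by omega) (by
        intro q h1 h2 h3 h4
        have hq := hpar q h1 h2 h3
        rw [hq.2, ha1.2]
        have := hc.closed (q + k - 1) (by omega) (by omega) (by omega)
        exact hrk _ (by omega) (by omega) (by omega) (by omega))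
  have hv := hc.invP_mem ht.1 ht.2 hc.trunk_out
  refine ⟨n + 1 - m, r, s, invP k m σ t, vR, vS, cutLower n t k m σ A, R, S,
    ⟨hTP, hhP.isPlanar⟩, hR, hS, hv.1, hv.2, h1, h2, h3, h4, by omega, k, hk, by omega, ?_, ?_⟩
  · intro hlt'
    obtain ⟨e1, e2, e3⟩ := hlt (by omega)
    rw [← e1, ← hm, ← e2]
    exact ⟨hA, by omega, by omega⟩
  · intro hgt'
    obtain ⟨e1, e2, e3⟩ := hgt (by omega)
    rw [← e1, ← hm, show vR + s = σ by omega]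
    exact ⟨hA, by omega, by omega⟩
end
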